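/- arXiv:1010.5896 — 11 statements merged into one kernel-verified Lean document; each statement's English description precedes it below -/
import Mathlib

section
/- Let (N, [·,...,·]) be an n-ary Nambu algebra and let ρ: N → N be a linear map which is an algebra endomorphism, i.e. ρ([x₁,...,xₙ]) = [ρ(x₁),...,ρ(xₙ)] for all xᵢ ∈ N. Then (N, ρ∘[·,...,·], ρ) is an n-ary multiplicative Hom-Nambu algebra; that is, the n-linear bracket {x₁,...,xₙ} := ρ([x₁,...,xₙ]) together with the twist maps α₁ = ... = α_{n−1} = ρ satisfies the Hom-Nambu identity, and ρ({x₁,...,xₙ}) = {ρ(x₁),...,ρ(xₙ)} for all xᵢ ∈ N. -/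
/-- Let `(N, [·,...,·])` be an `(n+1)`-ary Nambu algebra (the bracket `br` is an
`(n+1)`-linear map satisfying the Nambu (Filippov) identity) and let `ρ : N → N` be a linear map
which is an algebra endomorphism.  Then `(N, ρ ∘ [·,...,·], ρ)` is an `(n+1)`-ary multiplicative
Hom-Nambu algebra: the bracket `{x₁,...,x_{n+1}} := ρ [x₁,...,x_{n+1}]` satisfies the Hom-Nambu
identity with twist maps `α₁ = ... = αₙ = ρ`, and `ρ {x₁,...} = {ρ x₁,...}`. -/
theorem nambu_endomorphism_yields_multiplicative_homNambu
    {K N : Type*} [Field K] [CharZero K] [AddCommGroup N] [Module K N] (n : ℕ)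
    (br : MultilinearMap K (fun _ : Fin (n + 1) => N) N)
    (hNambu : ∀ (x : Fin n → N) (y : Fin (n + 1) → N),
      br (Fin.snoc x (br y)) =
        ∑ i : Fin (n + 1), br (Function.update y i (br (Fin.snoc x (y i)))))
    (ρ : N →ₗ[K] N)
    (hρ : ∀ v : Fin (n + 1) → N, ρ (br v) = br (fun i => ρ (v i))) :
    (∀ (x : Fin n → N) (y : Fin (n + 1) → N),
      ρ (br (Fin.snoc (fun j => ρ (x j)) (ρ (br y)))) =
        ∑ i : Fin (n + 1),
          ρ (br (Function.update (fun j => ρ (y j)) i (ρ (br (Fin.snoc x (y i)))))))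
    ∧ (∀ v : Fin (n + 1) → N, ρ (ρ (br v)) = ρ (br (fun i => ρ (v i)))) := by
  have h1 : ∀ (x : Fin n → N) (z : N),
      br (Fin.snoc (fun j => ρ (x j)) (ρ z)) = ρ (br (Fin.snoc x z)) := by
    intro x z
    rw [hρ]
    congr 1
    funext i
    refine Fin.lastCases ?_ (fun j => ?_) i
    · simp only [Fin.snoc_last]
    · simp only [Fin.snoc_castSucc]
  have h2 : ∀ (y : Fin (n + 1) → N) (i : Fin (n + 1)) (z : N),
      br (Function.update (fun j => ρ (y j)) i (ρ z)) = ρ (br (Function.update y i z)) := by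
    intro y i z
    rw [hρ]
    congr 1
    funext j
    by_cases h : j = i
    · subst h
      simp only [Function.update_self]
    · simp only [Function.update_of_ne h]
  refine ⟨fun x y => ?_, fun v => by rw [hρ v]⟩
  rw [h1, hNambu, map_sum, map_sum]
  exact Finset.sum_congr rfl fun i _ => by rw [h2]
end

section
/- Let (N, [·,...,·]) be an n-ary Nambu-Lie algebra (an n-ary Nambu algebra whose bracket is skew-symmetric) and let ρ: N → N be a linear map with ρ([x₁,...,xₙ]) = [ρ(x₁),...,ρ(xₙ)] for all xᵢ ∈ N. Then (N, ρ∘[·,...,·], ρ) is an n-ary multiplicative Hom-Nambu-Lie algebra: the bracket {x₁,...,xₙ} := ρ([x₁,...,xₙ]) is skew-symmetric, satisfies the Hom-Nambu identity with twist maps α₁ = ... = α_{n−1} = ρ, and ρ({x₁,...,xₙ}) = {ρ(x₁),...,ρ(xₙ)}. -/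
/-- Let `(N, [·,...,·])` be an `(n+1)`-ary Nambu-Lie algebra (the `(n+1)`-linear
bracket `br` is skew-symmetric and satisfies the Nambu (Filippov) identity) and let `ρ : N → N` be
a linear map with `ρ [x₁,...,x_{n+1}] = [ρ x₁,...,ρ x_{n+1}]`.  Then `(N, ρ ∘ [·,...,·], ρ)` is an
`(n+1)`-ary multiplicative Hom-Nambu-Lie algebra: the bracket `{x₁,...} := ρ [x₁,...]` is
skew-symmetric, satisfies the Hom-Nambu identity with twist maps `α₁ = ... = αₙ = ρ`, and
`ρ {x₁,...} = {ρ x₁,...}`. -/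
theorem nambuLie_endomorphism_yields_multiplicative_homNambuLie
    {K N : Type*} [Field K] [CharZero K] [AddCommGroup N] [Module K N] (n : ℕ)
    (br : MultilinearMap K (fun _ : Fin (n + 1) => N) N)
    (hskew : ∀ (σ : Equiv.Perm (Fin (n + 1))) (v : Fin (n + 1) → N),
      br (v ∘ σ) = ((Equiv.Perm.sign σ : ℤ)) • br v)
    (hNambu : ∀ (x : Fin n → N) (y : Fin (n + 1) → N),
      br (Fin.snoc x (br y)) =
        ∑ i : Fin (n + 1), br (Function.update y i (br (Fin.snoc x (y i)))))
    (ρ : N →ₗ[K] N)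
    (hρ : ∀ v : Fin (n + 1) → N, ρ (br v) = br (fun i => ρ (v i))) :
    (∀ (σ : Equiv.Perm (Fin (n + 1))) (v : Fin (n + 1) → N),
      ρ (br (v ∘ σ)) = ((Equiv.Perm.sign σ : ℤ)) • ρ (br v))
    ∧ (∀ (x : Fin n → N) (y : Fin (n + 1) → N),
      ρ (br (Fin.snoc (fun j => ρ (x j)) (ρ (br y)))) =
        ∑ i : Fin (n + 1),
          ρ (br (Function.update (fun j => ρ (y j)) i (ρ (br (Fin.snoc x (y i)))))))
    ∧ (∀ v : Fin (n + 1) → N, ρ (ρ (br v)) = ρ (br (fun i => ρ (v i)))) := by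
  refine ⟨fun σ v => by rw [hskew, map_zsmul], fun x y => ?_, fun v => by rw [hρ v]⟩
  have h1 : ρ (br (Fin.snoc x (br y))) =
      br (Fin.snoc (fun j => ρ (x j)) (ρ (br y))) := by
    rw [hρ]
    congr 1
    funext i
    refine Fin.lastCases ?_ (fun j => ?_) i
    · simp only [Fin.snoc_last]
    · simp only [Fin.snoc_castSucc]
  have h2 : ∀ i : Fin (n + 1), ρ (br (Function.update y i (br (Fin.snoc x (y i))))) =
      br (Function.update (fun j => ρ (y j)) i (ρ (br (Fin.snoc x (y i))))) := by
    intro i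
    rw [hρ (Function.update y i (br (Fin.snoc x (y i))))]
    congr 1
    funext j
    by_cases h : j = i
    · subst h
      simp only [Function.update_self]
    · simp only [Function.update_of_ne h]
  rw [← h1, hNambu, map_sum, map_sum]
  exact Finset.sum_congr rfl fun i _ => by rw [h2 i]
end

section
/- Let (N, [·,...,·], α) be an n-ary multiplicative Hom-Nambu-Lie algebra, let k ≥ 1, and let x = (x₁,...,x_{n−1}) ∈ N^{n−1} satisfy α(xᵢ) = xᵢ for all i. Define ad_k(x) ∈ End(N) by ad_k(x)(y) = [x₁,...,x_{n−1},α^k(y)]. Then ad_k(x) is an α^{k+1}-derivation of N: ad_k(x)∘α = α∘ad_k(x) and ad_k(x)([y₁,...,yₙ]) = Σ_{i=1}^{n} [α^{k+1}(y₁),...,α^{k+1}(y_{i−1}),ad_k(x)(yᵢ),α^{k+1}(y_{i+1}),...,α^{k+1}(yₙ)] for all yᵢ ∈ N. -/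
/-- Let `(N, [·,...,·], α)` be an `(n+1)`-ary multiplicative Hom-Nambu-Lie
algebra (`br` is a skew-symmetric, i.e. alternating, `(n+1)`-linear bracket, `α` a linear map,
with multiplicativity and the Hom-Nambu identity), let `k ≥ 1`, and let `x = (x₁,...,xₙ)` satisfy
`α xᵢ = xᵢ`.  Define `ad_k(x) (y) = [x₁,...,xₙ, α^k y]`.  Then `ad_k(x)` is an
`α^{k+1}`-derivation: it commutes with `α` and satisfies the `α^{k+1}`-derivation rule. -/
theorem adjoint_is_alpha_pow_succ_derivation
    {K N : Type*} [Field K] [CharZero K] [AddCommGroup N] [Module K N] (n : ℕ)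
    (br : AlternatingMap K N N (Fin (n + 1))) (α : N →ₗ[K] N)
    (hmult : ∀ v : Fin (n + 1) → N, α (br v) = br (fun i => α (v i)))
    (hNambu : ∀ (x : Fin n → N) (y : Fin (n + 1) → N),
      br (Fin.snoc (fun j => α (x j)) (br y)) =
        ∑ i : Fin (n + 1),
          br (Function.update (fun j => α (y j)) i (br (Fin.snoc x (y i)))))
    (k : ℕ) (hk : 1 ≤ k) (x : Fin n → N) (hx : ∀ i, α (x i) = x i) :
    (∀ y : N, br (Fin.snoc x ((α ^ k) (α y))) = α (br (Fin.snoc x ((α ^ k) y))))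
    ∧ (∀ y : Fin (n + 1) → N,
      br (Fin.snoc x ((α ^ k) (br y))) =
        ∑ i : Fin (n + 1),
          br (Function.update (fun j => (α ^ (k + 1)) (y j)) i
            (br (Fin.snoc x ((α ^ k) (y i)))))) := by
  have hpow : ∀ (m : ℕ) (v : Fin (n + 1) → N),
      (α ^ m) (br v) = br (fun i => (α ^ m) (v i)) := by
    intro m
    induction m with
    | zero => intro v; simp
    | succ m ih =>
      intro v
      simp only [pow_succ', Module.End.mul_apply]
      rw [ih, hmult]
  have hcomm : ∀ y : N, (α ^ k) (α y) = α ((α ^ k) y) := by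
    intro y
    rw [← Module.End.mul_apply, ← Module.End.mul_apply, ← pow_succ, ← pow_succ']
  constructor
  · intro y
    rw [hmult, hcomm]
    congr 1
    funext i
    refine Fin.lastCases ?_ (fun j => ?_) i
    · simp
    · simp [hx]
  · intro y
    have h := hNambu x (fun i => (α ^ k) (y i))
    have hx' : (fun j => α (x j)) = x := funext hx
    rw [hx', ← hpow] at h
    rw [h]
    simp only [pow_succ', Module.End.mul_apply]
end

section
/- Let (N, [·,...,·], α) be an n-ary multiplicative Hom-Nambu-Lie algebra and let k, k' ≥ 0. If D is an α^k-derivation of N and D' is an α^{k'}-derivation of N, then the commutator [D, D'] = D∘D' − D'∘D is an α^{k+k'}-derivation of N. -/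
/-- Let `(N, [·,...,·], α)` be an `(n+1)`-ary multiplicative Hom-Nambu-Lie
algebra and `k, k' ≥ 0`.  If `D` is an `α^k`-derivation and `D'` an `α^{k'}`-derivation, then the
commutator `[D, D'] = D∘D' − D'∘D` is an `α^{k+k'}`-derivation: it commutes with `α` and
satisfies the `α^{k+k'}`-derivation rule. -/
theorem commutator_of_derivations_is_derivation
    {K N : Type*} [Field K] [CharZero K] [AddCommGroup N] [Module K N] (n : ℕ)
    (br : AlternatingMap K N N (Fin (n + 1))) (α : N →ₗ[K] N)
    (hmult : ∀ v : Fin (n + 1) → N, α (br v) = br (fun i => α (v i)))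
    (hNambu : ∀ (x : Fin n → N) (y : Fin (n + 1) → N),
      br (Fin.snoc (fun j => α (x j)) (br y)) =
        ∑ i : Fin (n + 1),
          br (Function.update (fun j => α (y j)) i (br (Fin.snoc x (y i)))))
    (k k' : ℕ) (D D' : N →ₗ[K] N)
    (hDα : ∀ y, D (α y) = α (D y))
    (hD : ∀ v : Fin (n + 1) → N,
      D (br v) = ∑ i : Fin (n + 1),
        br (Function.update (fun j => (α ^ k) (v j)) i (D (v i))))
    (hD'α : ∀ y, D' (α y) = α (D' y))
    (hD' : ∀ v : Fin (n + 1) → N,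
      D' (br v) = ∑ i : Fin (n + 1),
        br (Function.update (fun j => (α ^ k') (v j)) i (D' (v i)))) :
    (∀ y, (D ∘ₗ D' - D' ∘ₗ D) (α y) = α ((D ∘ₗ D' - D' ∘ₗ D) y))
    ∧ (∀ v : Fin (n + 1) → N,
      (D ∘ₗ D' - D' ∘ₗ D) (br v) = ∑ i : Fin (n + 1),
        br (Function.update (fun j => (α ^ (k + k')) (v j)) i
          ((D ∘ₗ D' - D' ∘ₗ D) (v i)))) := by
  have pc : ∀ (E : N →ₗ[K] N), (∀ y, E (α y) = α (E y)) →
      ∀ (m : ℕ) (y : N), E ((α ^ m) y) = (α ^ m) (E y) := by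
    intro E hE m
    induction m with
    | zero => intro y; simp
    | succ m ih =>
      intro y
      rw [pow_succ, Module.End.mul_apply, Module.End.mul_apply, ih, hE]
  have hadd : ∀ (a b : ℕ) (y : N), (α ^ a) ((α ^ b) y) = (α ^ (a + b)) y := by
    intro a b y
    rw [pow_add, Module.End.mul_apply]
  refine ⟨fun y => by simp [hDα, hD'α], fun v => ?_⟩
  have h1 : D (D' (br v)) = ∑ i : Fin (n + 1), ∑ j : Fin (n + 1),
      br (fun l => if l = j then (if l = i then D (D' (v l)) else (α ^ k') (D (v l)))
        else (if l = i then (α ^ k) (D' (v l)) else (α ^ (k + k')) (v l))) := by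
    rw [hD', map_sum]
    refine Finset.sum_congr rfl fun i _ => ?_
    rw [hD]
    refine Finset.sum_congr rfl fun j _ => congrArg br (funext fun l => ?_)
    simp only [Function.update_apply]
    by_cases hj : l = j
    · subst hj
      by_cases hi : l = i
      · subst hi
        simp only [if_true]
      · simp only [if_true, if_neg hi, pc D hDα]
    · by_cases hi : l = i
      · subst hi
        simp only [if_true, if_neg hj]
      · simp only [if_neg hj, if_neg hi, hadd]
  have h2 : D' (D (br v)) = ∑ j : Fin (n + 1), ∑ i : Fin (n + 1),
      br (fun l => if l = j then (if l = i then D' (D (v l)) else (α ^ k') (D (v l)))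
        else (if l = i then (α ^ k) (D' (v l)) else (α ^ (k + k')) (v l))) := by
    rw [hD, map_sum]
    refine Finset.sum_congr rfl fun j _ => ?_
    rw [hD']
    refine Finset.sum_congr rfl fun i _ => congrArg br (funext fun l => ?_)
    simp only [Function.update_apply]
    by_cases hi : l = i
    · subst hi
      by_cases hj : l = j
      · subst hj
        simp only [if_true]
      · simp only [if_true, if_neg hj, pc D' hD'α]
    · by_cases hj : l = j
      · subst hj
        simp only [if_true, if_neg hi]
      · simp only [if_neg hi, if_neg hj, hadd, add_comm k' k]
  rw [LinearMap.sub_apply, LinearMap.comp_apply, LinearMap.comp_apply, h1, h2,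
    Finset.sum_comm (f := fun j i => br (fun l => if l = j then
      (if l = i then D' (D (v l)) else (α ^ k') (D (v l)))
        else (if l = i then (α ^ k) (D' (v l)) else (α ^ (k + k')) (v l)))),
    ← Finset.sum_sub_distrib]
  refine Finset.sum_congr rfl fun i _ => ?_
  rw [← Finset.sum_sub_distrib, Finset.sum_eq_single i]
  · rw [LinearMap.sub_apply, LinearMap.comp_apply, LinearMap.comp_apply,
      AlternatingMap.map_update_sub]
    congr 2 <;>
    · funext l
      simp only [Function.update_apply]
      split_ifs <;> subst_vars <;> rfl
  · intro j _ hj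
    rw [sub_eq_zero]
    refine congrArg br (funext fun l => ?_)
    split_ifs <;> first | rfl | exact absurd ((Eq.symm ‹l = j›).trans ‹l = i›) hj
  · simp
end

section
/- Let (N, [·,...,·], α) be an n-ary multiplicative Hom-Nambu-Lie algebra. The subspace Der(N) of End(N) spanned by ⋃_{k≥0} Der_{α^k}(N) is closed under the commutator [D, D'] = D∘D' − D'∘D, and hence (Der(N), [·,·]) is a Lie algebra; moreover the subspace Inn(N) spanned by all inner derivations ad_k(x) (over all k ≥ 1 and all x = (x₁,...,x_{n−1}) with α(xᵢ) = xᵢ) is an ideal of this Lie algebra: [Der(N), Inn(N)] ⊆ Inn(N). -/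
/-- The commutator of endomorphisms respects spans in both arguments. -/
theorem comm_mem_of_span {K N : Type*} [Field K] [AddCommGroup N] [Module K N]
    (S T : Set (N →ₗ[K] N)) (P : Submodule K (N →ₗ[K] N))
    (h : ∀ D ∈ S, ∀ E ∈ T, D ∘ₗ E - E ∘ₗ D ∈ P) :
    ∀ D ∈ Submodule.span K S, ∀ E ∈ Submodule.span K T, D ∘ₗ E - E ∘ₗ D ∈ P := by
  intro D hD E hE
  induction hD, hE using Submodule.span_induction₂ with
  | mem_mem x y hx hy => exact h x hx y hy
  | zero_left y hy => simp
  | zero_right x hx => simp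
  | add_left x y z hx hy hz h1 h2 =>
    have := P.add_mem h1 h2
    convert this using 1
    simp only [LinearMap.add_comp, LinearMap.comp_add]; abel
  | add_right x y z hx hy hz h1 h2 =>
    have := P.add_mem h1 h2
    convert this using 1
    simp only [LinearMap.add_comp, LinearMap.comp_add]; abel
  | smul_left r x y hx hy h1 =>
    have := P.smul_mem r h1
    convert this using 1
    simp only [LinearMap.smul_comp, LinearMap.comp_smul, smul_sub]
  | smul_right r x y hx hy h1 =>
    have := P.smul_mem r h1
    convert this using 1
    simp only [LinearMap.smul_comp, LinearMap.comp_smul, smul_sub]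

theorem comm_pow_apply {K N : Type*} [Field K] [AddCommGroup N] [Module K N]
    (D α : N →ₗ[K] N) (h : ∀ y, D (α y) = α (D y)) (k : ℕ) (y : N) :
    D ((α ^ k) y) = (α ^ k) (D y) := by
  induction k generalizing y with
  | zero => simp
  | succ k ih => rw [pow_succ, Module.End.mul_apply, ih, h, Module.End.mul_apply]

theorem der_comp {K N : Type*} [Field K] [AddCommGroup N] [Module K N] {m : ℕ}
    (br : AlternatingMap K N N (Fin m)) (α D E : N →ₗ[K] N) (k s : ℕ)
    (hD : ∀ v : Fin m → N, D (br v) = ∑ i : Fin m,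
        br (Function.update (fun j => (α ^ k) (v j)) i (D (v i))))
    (hE : ∀ v : Fin m → N, E (br v) = ∑ i : Fin m,
        br (Function.update (fun j => (α ^ s) (v j)) i (E (v i))))
    (hDc : ∀ y, D (α y) = α (D y)) (v : Fin m → N) :
    D (E (br v)) = ∑ i : Fin m, ∑ j : Fin m,
      if i = j then br (Function.update (fun j => (α ^ (k + s)) (v j)) i (D (E (v i))))
      else br (Function.update (Function.update (fun j => (α ^ (k + s)) (v j)) i
        ((α ^ k) (E (v i)))) j ((α ^ s) (D (v j)))) := by
  rw [hE, map_sum]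
  refine Finset.sum_congr rfl fun i _ => ?_
  rw [hD]
  refine Finset.sum_congr rfl fun j _ => ?_
  split_ifs with hij
  · subst hij
    congr 1
    ext l
    by_cases hl : l = i
    · subst hl; simp
    · simp [hl, pow_add]
  · congr 1
    ext l
    by_cases hl : l = j
    · subst hl
      simp [Ne.symm hij, comm_pow_apply D α hDc]
    · by_cases hl' : l = i
      · subst hl'; simp [hl]
      · simp [hl, hl', pow_add]

/-- For an `(n+1)`-ary multiplicative Hom-Nambu-Lie algebra `(N, br, α)`, the
subspace `Der(N)` of `End(N)` spanned by the union over `k ≥ 0` of the sets of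
`α^k`-derivations is closed under the commutator `[D, D'] = D∘D' − D'∘D` (hence is a Lie algebra
under the commutator bracket), and the subspace `Inn(N)` spanned by the inner derivations
`ad_k(x) : y ↦ [x₁,...,xₙ, α^k y]` (over `k ≥ 1` and tuples `x` with `α xᵢ = xᵢ`) is an ideal:
`[Der(N), Inn(N)] ⊆ Inn(N)`. -/
theorem derivations_lie_algebra_inner_ideal
    {K N : Type*} [Field K] [CharZero K] [AddCommGroup N] [Module K N] (n : ℕ)
    (br : AlternatingMap K N N (Fin (n + 1))) (α : N →ₗ[K] N)
    (hmult : ∀ v : Fin (n + 1) → N, α (br v) = br (fun i => α (v i)))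
    (hNambu : ∀ (x : Fin n → N) (y : Fin (n + 1) → N),
      br (Fin.snoc (fun j => α (x j)) (br y)) =
        ∑ i : Fin (n + 1),
          br (Function.update (fun j => α (y j)) i (br (Fin.snoc x (y i)))))
    (Der Inn : Submodule K (N →ₗ[K] N))
    (hDer : Der = Submodule.span K {D : N →ₗ[K] N | ∃ k : ℕ,
      (∀ y, D (α y) = α (D y)) ∧
      ∀ v : Fin (n + 1) → N, D (br v) = ∑ i : Fin (n + 1),
        br (Function.update (fun j => (α ^ k) (v j)) i (D (v i)))})
    (hInn : Inn = Submodule.span K {D : N →ₗ[K] N | ∃ k : ℕ, 1 ≤ k ∧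
      ∃ x : Fin n → N, (∀ i, α (x i) = x i) ∧
        ∀ y, D y = br (Fin.snoc x ((α ^ k) y))}) :
    (∀ D ∈ Der, ∀ D' ∈ Der, D ∘ₗ D' - D' ∘ₗ D ∈ Der)
    ∧ (∀ D ∈ Der, ∀ E ∈ Inn, D ∘ₗ E - E ∘ₗ D ∈ Inn) := by
  subst hDer hInn
  constructor
  · refine comm_mem_of_span _ _ _ ?_
    rintro D ⟨k, hDc, hD⟩ E ⟨s, hEc, hE⟩
    refine Submodule.subset_span ⟨k + s, ?_, ?_⟩
    · intro y
      simp [hDc, hEc]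
    · intro v
      simp only [LinearMap.sub_apply, LinearMap.comp_apply]
      rw [der_comp br α D E k s hD hE hDc, der_comp br α E D s k hE hD hEc,
        Finset.sum_comm (s := Finset.univ) (t := Finset.univ) (f := fun i j : Fin (n + 1) =>
          if i = j then br (Function.update (fun j => (α ^ (s + k)) (v j)) i (E (D (v i))))
          else br (Function.update (Function.update (fun j => (α ^ (s + k)) (v j)) i
            ((α ^ s) (D (v i)))) j ((α ^ k) (E (v j))))),
        ← Finset.sum_sub_distrib]
      refine Finset.sum_congr rfl fun i _ => ?_
      rw [← Finset.sum_sub_distrib, Finset.sum_eq_single i]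
      · simp only [if_true]
        rw [add_comm s k, AlternatingMap.map_update_sub]
      · intro j _ hj
        rw [if_neg hj.symm, if_neg hj, add_comm s k, Function.update_comm hj, sub_self]
      · simp
  · refine comm_mem_of_span _ _ _ ?_
    rintro D ⟨k, hDc, hD⟩ E ⟨m, hm, x, hx, hE⟩
    have hxk : ∀ i, (α ^ k) (x i) = x i := by
      intro i
      rw [Module.End.pow_apply]
      exact Function.iterate_fixed (hx i) k
    let A : (Fin n → N) → (N →ₗ[K] N) := fun z =>
      (br.toMultilinearMap.toLinearMap (Fin.snoc z 0) (Fin.last n)) ∘ₗ (α ^ (k + m))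
    have hA : ∀ z y, A z y = br (Fin.snoc z ((α ^ (k + m)) y)) := by
      intro z y
      simp [A, Fin.update_snoc_last]
    have key : D ∘ₗ E - E ∘ₗ D = ∑ i : Fin n, A (Function.update x i (D (x i))) := by
      ext y
      simp only [LinearMap.sub_apply, LinearMap.comp_apply, LinearMap.sum_apply, hA]
      have hs : (fun j => (α ^ k) ((Fin.snoc x ((α ^ m) y) : Fin (n + 1) → N) j)) =
          (Fin.snoc x ((α ^ (k + m)) y) : Fin (n + 1) → N) := by
        ext j
        refine Fin.lastCases ?_ (fun j => ?_) j
        · simp [pow_add]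
        · simp [hxk]
      rw [hE, hE, hD, hs, Fin.sum_univ_castSucc]
      simp only [Fin.snoc_castSucc, Fin.snoc_last, Fin.update_snoc_last, Fin.snoc_update,
        comm_pow_apply D α hDc, add_sub_cancel_right]
    rw [key]
    refine Submodule.sum_mem _ fun i _ => Submodule.subset_span
      ⟨k + m, by omega, Function.update x i (D (x i)), ?_, hA _⟩
    intro j
    by_cases hj : j = i
    · subst hj; simp [← hDc, hx]
    · simp [hj, hx]
end

section
/- Let (N, [·,...,·], α) be an n-ary multiplicative Hom-Nambu-Lie algebra, let k ≥ 1 and k' ≥ 0, let x = (x₁,...,x_{n−1}) ∈ N^{n−1} satisfy α(xᵢ) = xᵢ for all i, and let D be an α^{k'}-derivation of N. Then for all y ∈ N, [D, ad_k(x)](y) = Σ_{i=1}^{n−1} [x₁,...,x_{i−1},D(xᵢ),x_{i+1},...,x_{n−1},α^{k+k'}(y)]; in particular the commutator of an α^{k'}-derivation with the inner derivation ad_k(x) is a sum of inner derivations ad_{k+k'}(x₁,...,D(xᵢ),...,x_{n−1}). -/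
/-- Let `(N, br, α)` be an `(n+1)`-ary multiplicative Hom-Nambu-Lie algebra,
`k ≥ 1`, `k' ≥ 0`, let `x = (x₁,...,xₙ)` satisfy `α xᵢ = xᵢ`, and let `D` be an
`α^{k'}`-derivation.  Then for all `y`,
`[D, ad_k(x)] y = Σᵢ [x₁,...,D xᵢ,...,xₙ, α^{k+k'} y]`,
i.e. the commutator of `D` with the inner derivation `ad_k(x)` is the sum of the inner
derivations `ad_{k+k'}(x₁,...,D xᵢ,...,xₙ)`. -/
theorem commutator_derivation_inner
    {K N : Type*} [Field K] [CharZero K] [AddCommGroup N] [Module K N] (n : ℕ)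
    (br : AlternatingMap K N N (Fin (n + 1))) (α : N →ₗ[K] N)
    (hmult : ∀ v : Fin (n + 1) → N, α (br v) = br (fun i => α (v i)))
    (hNambu : ∀ (x : Fin n → N) (y : Fin (n + 1) → N),
      br (Fin.snoc (fun j => α (x j)) (br y)) =
        ∑ i : Fin (n + 1),
          br (Function.update (fun j => α (y j)) i (br (Fin.snoc x (y i)))))
    (k k' : ℕ) (hk : 1 ≤ k)
    (x : Fin n → N) (hx : ∀ i, α (x i) = x i)
    (D : N →ₗ[K] N)
    (hDα : ∀ y, D (α y) = α (D y))
    (hD : ∀ v : Fin (n + 1) → N,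
      D (br v) = ∑ i : Fin (n + 1),
        br (Function.update (fun j => (α ^ k') (v j)) i (D (v i)))) :
    ∀ y : N,
      D (br (Fin.snoc x ((α ^ k) y))) - br (Fin.snoc x ((α ^ k) (D y))) =
        ∑ i : Fin n,
          br (Fin.snoc (Function.update x i (D (x i))) ((α ^ (k + k')) y)) := by
  intro y
  have hxk : ∀ (m : ℕ) (i : Fin n), (α ^ m) (x i) = x i := by
    intro m i
    induction m with
    | zero => simp
    | succ m ih => rw [pow_succ, Module.End.mul_apply, hx, ih]
  have hDk : ∀ (m : ℕ) (z : N), D ((α ^ m) z) = (α ^ m) (D z) := by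
    intro m
    induction m with
    | zero => intro z; simp
    | succ m ih =>
      intro z
      rw [pow_succ, Module.End.mul_apply, Module.End.mul_apply, ih, hDα]
  have hv : (fun j => (α ^ k') ((Fin.snoc x ((α ^ k) y) : Fin (n + 1) → N) j))
      = (Fin.snoc x ((α ^ (k + k')) y) : Fin (n + 1) → N) := by
    funext j
    refine Fin.lastCases ?_ (fun i => ?_) j
    · rw [Fin.snoc_last, Fin.snoc_last, add_comm k k', pow_add, Module.End.mul_apply]
    · rw [Fin.snoc_castSucc, Fin.snoc_castSucc, hxk]
  rw [hD, hv, Fin.sum_univ_castSucc]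
  simp only [Fin.snoc_last, Fin.snoc_castSucc, Fin.update_snoc_last, ← Fin.snoc_update, hDk]
  rw [add_sub_cancel_right]
end

section
/- Let (N, [·,...,·], α) be an n-ary multiplicative Hom-Nambu-Lie algebra. Then the triple (L(N), [·,·]_α, α̃), where L(N) = ⋀^{n−1}N, is a Hom-Leibniz algebra; that is, for all x, y, z ∈ L(N): [α̃(x), [y, z]_α]_α = [[x, y]_α, α̃(z)]_α + [α̃(y), [x, z]_α]_α. -/
/-- The generator `v 0 ∧ ... ∧ v (n-1)` of the `n`-th exterior power `⋀[K]^n N`. -/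
def wedgeGen (K : Type*) {N : Type*} [Field K] [AddCommGroup N] [Module K N] (n : ℕ)
    (v : Fin n → N) : ⋀[K]^n N :=
  ⟨ExteriorAlgebra.ιMulti K n v, ExteriorAlgebra.ιMulti_range K n (Set.mem_range_self v)⟩

theorem wedgeGen_span_aux (K : Type*) {N : Type*} [Field K] [AddCommGroup N] [Module K N] (n : ℕ) :
    Submodule.span K (Set.range (wedgeGen K (N := N) n)) = ⊤ :=
  exteriorPower.ιMulti_span K n N

theorem wedgeGen_update_sum_aux (K : Type*) {N : Type*} [Field K] [AddCommGroup N] [Module K N]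
    (n : ℕ) {ι : Type*} (s : Finset ι) (v : Fin n → N) (i : Fin n) (f : ι → N) :
    wedgeGen K n (Function.update v i (∑ k ∈ s, f k)) =
      ∑ k ∈ s, wedgeGen K n (Function.update v i (f k)) :=
  (exteriorPower.ιMulti K n (M := N)).toMultilinearMap.map_update_sum s i f v

theorem wedgeGen_update_add_aux (K : Type*) {N : Type*} [Field K] [AddCommGroup N] [Module K N]
    (n : ℕ) (v : Fin n → N) (i : Fin n) (a b : N) :
    wedgeGen K n (Function.update v i (a + b)) =
      wedgeGen K n (Function.update v i a) + wedgeGen K n (Function.update v i b) :=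
  (exteriorPower.ιMulti K n (M := N)).map_update_add v i a b

/-- Let `(N, br, α)` be an `(n+1)`-ary multiplicative Hom-Nambu-Lie algebra.
On `L(N) = ⋀^n N` consider `L(x₁∧...∧xₙ)·z = [x₁,...,xₙ,z]`,
`α̃(x₁∧...∧xₙ) = α(x₁)∧...∧α(xₙ)`, and the bilinear bracket
`[x, y]_α = Σᵢ α(y₁)∧...∧(L(x)·yᵢ)∧...∧α(yₙ)`.  Then `(L(N), [·,·]_α, α̃)` is a Hom-Leibniz
algebra: `[α̃ x, [y, z]_α]_α = [[x, y]_α, α̃ z]_α + [α̃ y, [x, z]_α]_α` for all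
`x, y, z ∈ L(N)`. -/
theorem exteriorPower_homLeibniz_of_homNambuLie
    {K N : Type*} [Field K] [CharZero K] [AddCommGroup N] [Module K N] (n : ℕ)
    (br : AlternatingMap K N N (Fin (n + 1))) (α : N →ₗ[K] N)
    (hmult : ∀ v : Fin (n + 1) → N, α (br v) = br (fun i => α (v i)))
    (hNambu : ∀ (x : Fin n → N) (y : Fin (n + 1) → N),
      br (Fin.snoc (fun j => α (x j)) (br y)) =
        ∑ i : Fin (n + 1),
          br (Function.update (fun j => α (y j)) i (br (Fin.snoc x (y i)))))
    (αt : ⋀[K]^n N →ₗ[K] ⋀[K]^n N)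
    (hαt : ∀ v : Fin n → N, αt (wedgeGen K n v) = wedgeGen K n (fun i => α (v i)))
    (B : ⋀[K]^n N →ₗ[K] ⋀[K]^n N →ₗ[K] ⋀[K]^n N)
    (hB : ∀ v w : Fin n → N,
      B (wedgeGen K n v) (wedgeGen K n w) =
        ∑ i : Fin n,
          wedgeGen K n (Function.update (fun j => α (w j)) i (br (Fin.snoc v (w i))))) :
    ∀ x y z : ⋀[K]^n N,
      B (αt x) (B y z) = B (B x y) (αt z) + B (αt y) (B x z) := by
  have hmap : ∀ (v : Fin n → N) (a : N),
      br (Fin.snoc (fun j => α (v j)) (α a)) = α (br (Fin.snoc v a)) := by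
    intro v a
    rw [hmult]
    congr 1
    funext i
    refine Fin.lastCases ?_ (fun j => ?_) i <;> simp
  -- the double bracket on generators
  have hdouble : ∀ v w u : Fin n → N,
      B (αt (wedgeGen K n v)) (B (wedgeGen K n w) (wedgeGen K n u)) =
        ∑ i, ∑ j, if i = j then
            wedgeGen K n (Function.update (fun k => α (α (u k))) i
              (br (Fin.snoc (fun k => α (v k)) (br (Fin.snoc w (u i))))))
          else wedgeGen K n (Function.update (Function.update (fun k => α (α (u k))) i
              (α (br (Fin.snoc w (u i))))) j (α (br (Fin.snoc v (u j))))) := by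
    intro v w u
    rw [hαt, hB, map_sum]
    refine Finset.sum_congr rfl fun i _ => ?_
    rw [hB]
    refine Finset.sum_congr rfl fun j _ => ?_
    have h1 : (fun k => α (Function.update (fun k => α (u k)) i (br (Fin.snoc w (u i))) k)) =
        Function.update (fun k => α (α (u k))) i (α (br (Fin.snoc w (u i)))) := by
      funext k
      by_cases hk : k = i
      · subst hk; simp
      · simp [hk]
    rw [h1]
    split_ifs with hij
    · subst hij
      simp
    · rw [Function.update_of_ne (Ne.symm hij), hmap]
  have hnam : ∀ (v w : Fin n → N) (a : N),
      br (Fin.snoc (fun k => α (v k)) (br (Fin.snoc w a))) =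
        (∑ k : Fin n, br (Fin.snoc (Function.update (fun j => α (w j)) k (br (Fin.snoc v (w k))))
          (α a))) + br (Fin.snoc (fun k => α (w k)) (br (Fin.snoc v a))) := by
    intro v w a
    have h2 : (fun j => α ((Fin.snoc w a : Fin (n + 1) → N) j)) =
        (Fin.snoc (fun k => α (w k)) (α a) : Fin (n + 1) → N) := by
      funext i
      refine Fin.lastCases ?_ (fun j => ?_) i <;> simp
    rw [hNambu, Fin.sum_univ_castSucc, h2]
    simp [Fin.snoc_update, Fin.update_snoc_last]
  have hgen : ∀ v w u : Fin n → N,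
      B (αt (wedgeGen K n v)) (B (wedgeGen K n w) (wedgeGen K n u)) =
        B (B (wedgeGen K n v) (wedgeGen K n w)) (αt (wedgeGen K n u)) +
        B (αt (wedgeGen K n w)) (B (wedgeGen K n v) (wedgeGen K n u)) := by
    intro v w u
    have hmid : B (B (wedgeGen K n v) (wedgeGen K n w)) (αt (wedgeGen K n u)) =
        ∑ i, ∑ j, if i = j then
          wedgeGen K n (Function.update (fun k => α (α (u k))) i
            (∑ k : Fin n, br (Fin.snoc (Function.update (fun j => α (w j)) k
              (br (Fin.snoc v (w k)))) (α (u i))))) else 0 := by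
      rw [hαt, hB v w, map_sum, LinearMap.sum_apply]
      simp only [hB, Finset.sum_ite_eq, Finset.mem_univ, if_true, wedgeGen_update_sum_aux]
      exact Finset.sum_comm
    rw [hdouble v w u, hdouble w v u, hmid]
    conv_rhs => rw [add_comm, Finset.sum_comm]
    rw [← Finset.sum_add_distrib]
    refine Finset.sum_congr rfl fun i _ => ?_
    rw [← Finset.sum_add_distrib]
    refine Finset.sum_congr rfl fun j _ => ?_
    by_cases hij : i = j
    · subst hij
      simp only [if_true]
      rw [hnam v w, wedgeGen_update_add_aux, add_comm]
    · rw [if_neg hij, if_neg (Ne.symm hij), if_neg hij, add_zero, Function.update_comm hij]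
  have hind : ∀ P : ⋀[K]^n N → Prop, (∀ v, P (wedgeGen K n v)) → P 0 →
      (∀ a b, P a → P b → P (a + b)) → (∀ (c : K) a, P a → P (c • a)) → ∀ x, P x := by
    intro P h1 h2 h3 h4 x
    have hx : x ∈ Submodule.span K (Set.range (wedgeGen K (N := N) n)) := by
      rw [wedgeGen_span_aux]; trivial
    induction hx using Submodule.span_induction with
    | mem x hx => obtain ⟨v, rfl⟩ := hx; exact h1 v
    | zero => exact h2
    | add a b _ _ ha hb => exact h3 a b ha hb
    | smul c a _ ha => exact h4 c a ha
  intro x y z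
  refine hind (fun x => B (αt x) (B y z) = B (B x y) (αt z) + B (αt y) (B x z))
    (fun v => ?_) (by simp) (fun a b ha hb => ?_) (fun c a ha => ?_) x
  · refine hind (fun y => B (αt (wedgeGen K n v)) (B y z) =
        B (B (wedgeGen K n v) y) (αt z) + B (αt y) (B (wedgeGen K n v) z))
      (fun w => ?_) (by simp) (fun a b ha hb => ?_) (fun c a ha => ?_) y
    · refine hind (fun z => B (αt (wedgeGen K n v)) (B (wedgeGen K n w) z) =
          B (B (wedgeGen K n v) (wedgeGen K n w)) (αt z) +
            B (αt (wedgeGen K n w)) (B (wedgeGen K n v) z))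
        (fun u => hgen v w u) (by simp) (fun a b ha hb => ?_) (fun c a ha => ?_) z
      · simp only [map_add, ha, hb]; abel
      · simp only [map_smul, ha, smul_add]
    · simp only [map_add, LinearMap.add_apply, ha, hb]; abel
    · simp only [map_smul, LinearMap.smul_apply, ha, smul_add]
  · simp only [map_add, LinearMap.add_apply, ha, hb]; abel
  · simp only [map_smul, LinearMap.smul_apply, ha, smul_add]
end

section
/- Let (N, [·,...,·], α) be an n-ary multiplicative Hom-Nambu-Lie algebra. Then the triple (N^{⊗(n−1)}, [·,·]_α, α^{⊗(n−1)}), where on T = N^{⊗(n−1)} one defines L(x₁⊗...⊗x_{n−1})·z = [x₁,...,x_{n−1},z], α̃(x₁⊗...⊗x_{n−1}) = α(x₁)⊗...⊗α(x_{n−1}), and [x, y]_α = Σ_{i=1}^{n−1} α(y₁)⊗...⊗α(y_{i−1})⊗(L(x)·yᵢ)⊗α(y_{i+1})⊗...⊗α(y_{n−1}), is a Hom-Leibniz algebra: [α̃(x), [y, z]_α]_α = [[x, y]_α, α̃(z)]_α + [α̃(y), [x, z]_α]_α for all x, y, z ∈ T. -/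
open scoped TensorProduct

/-- Let `(N, br, α)` be an `(n+1)`-ary multiplicative Hom-Nambu-Lie algebra.
On the tensor power `T = N^{⊗n}` consider `L(x₁⊗...⊗xₙ)·z = [x₁,...,xₙ,z]`,
`α̃(x₁⊗...⊗xₙ) = α(x₁)⊗...⊗α(xₙ)`, and the bilinear bracket
`[x, y]_α = Σᵢ α(y₁)⊗...⊗(L(x)·yᵢ)⊗...⊗α(yₙ)`.  Then `(T, [·,·]_α, α̃)` is a Hom-Leibniz
algebra: `[α̃ x, [y, z]_α]_α = [[x, y]_α, α̃ z]_α + [α̃ y, [x, z]_α]_α` for all `x, y, z ∈ T`. -/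
theorem tensorPower_homLeibniz_of_homNambuLie
    {K N : Type*} [Field K] [CharZero K] [AddCommGroup N] [Module K N] (n : ℕ)
    (br : AlternatingMap K N N (Fin (n + 1))) (α : N →ₗ[K] N)
    (hmult : ∀ v : Fin (n + 1) → N, α (br v) = br (fun i => α (v i)))
    (hNambu : ∀ (x : Fin n → N) (y : Fin (n + 1) → N),
      br (Fin.snoc (fun j => α (x j)) (br y)) =
        ∑ i : Fin (n + 1),
          br (Function.update (fun j => α (y j)) i (br (Fin.snoc x (y i)))))
    (αt : (⨂[K]^n N) →ₗ[K] ⨂[K]^n N)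
    (hαt : ∀ v : Fin n → N,
      αt (PiTensorProduct.tprod K v) = PiTensorProduct.tprod K (fun i => α (v i)))
    (B : (⨂[K]^n N) →ₗ[K] (⨂[K]^n N) →ₗ[K] ⨂[K]^n N)
    (hB : ∀ v w : Fin n → N,
      B (PiTensorProduct.tprod K v) (PiTensorProduct.tprod K w) =
        ∑ i : Fin n,
          PiTensorProduct.tprod K
            (Function.update (fun j => α (w j)) i (br (Fin.snoc v (w i))))) :
    ∀ x y z : ⨂[K]^n N,
      B (αt x) (B y z) = B (B x y) (αt z) + B (αt y) (B x z) := by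
  classical
  -- the multiplicativity of `α` with respect to the adjoint maps
  have hαL : ∀ (u : Fin n → N) (a : N),
      α (br (Fin.snoc u a)) = br (Fin.snoc (fun j => α (u j)) (α a)) := by
    intro u a
    rw [hmult]
    congr 1
    funext i
    refine Fin.lastCases ?_ (fun j => ?_) i <;> simp
  -- the Hom-Nambu identity rewritten with the last term separated
  have hD : ∀ (u v : Fin n → N) (a : N),
      br (Fin.snoc (fun j => α (u j)) (br (Fin.snoc v a))) =
        (∑ k : Fin n, br (Fin.snoc
          (Function.update (fun j => α (v j)) k (br (Fin.snoc u (v k)))) (α a))) +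
        br (Fin.snoc (fun j => α (v j)) (br (Fin.snoc u a))) := by
    intro u v a
    rw [hNambu, Fin.sum_univ_castSucc]
    have hs : (fun j => α ((Fin.snoc v a : Fin (n + 1) → N) j)) =
        (Fin.snoc (fun j => α (v j)) (α a) : Fin (n + 1) → N) := by
      funext i
      refine Fin.lastCases ?_ (fun j => ?_) i <;> simp
    rw [hs]
    congr 1
    · refine Finset.sum_congr rfl fun k _ => ?_
      rw [Fin.snoc_castSucc, Fin.snoc_update]
    · rw [Fin.snoc_last, Fin.update_snoc_last]
  have key : ∀ u v w : Fin n → N,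
      B (αt (PiTensorProduct.tprod K u))
          (B (PiTensorProduct.tprod K v) (PiTensorProduct.tprod K w)) =
        B (B (PiTensorProduct.tprod K u) (PiTensorProduct.tprod K v))
          (αt (PiTensorProduct.tprod K w)) +
        B (αt (PiTensorProduct.tprod K v))
          (B (PiTensorProduct.tprod K u) (PiTensorProduct.tprod K w)) := by
    intro u v w
    simp only [hαt, hB, map_sum, LinearMap.sum_apply]
    rw [Finset.sum_comm (γ := Fin n) (f := fun k i => PiTensorProduct.tprod K
      (Function.update (fun j => α (α (w j))) i (br (Fin.snoc
        (Function.update (fun j => α (v j)) k (br (Fin.snoc u (v k)))) (α (w i))))))]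
    have hsum : ∀ i : Fin n, (∑ k : Fin n, PiTensorProduct.tprod K
      (Function.update (fun j => α (α (w j))) i (br (Fin.snoc
        (Function.update (fun j => α (v j)) k (br (Fin.snoc u (v k)))) (α (w i)))))) =
        ∑ j : Fin n, if j = i then ∑ k : Fin n, PiTensorProduct.tprod K
      (Function.update (fun j => α (α (w j))) i (br (Fin.snoc
        (Function.update (fun j => α (v j)) k (br (Fin.snoc u (v k)))) (α (w i))))) else 0 := by
      intro i
      rw [Finset.sum_ite_eq' Finset.univ i]
      simp
    rw [Finset.sum_congr rfl fun i _ => hsum i]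
    rw [Finset.sum_comm (f := fun i j => PiTensorProduct.tprod K (Function.update
      (fun l => α (Function.update (fun j => α (w j)) i (br (Fin.snoc u (w i))) l)) j
      (br (Fin.snoc (fun j => α (v j))
        (Function.update (fun j => α (w j)) i (br (Fin.snoc u (w i))) j)))))]
    have hup : ∀ (i : Fin n) (a : N),
        (fun l => α (Function.update (fun j => α (w j)) i a l)) =
          Function.update (fun l => α (α (w l))) i (α a) := by
      intro i a
      funext l
      by_cases h : l = i
      · subst h; simp
      · simp [h]
    simp only [← Finset.sum_add_distrib, hup]
    refine Finset.sum_congr rfl fun i _ => Finset.sum_congr rfl fun j _ => ?_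
    by_cases h : j = i
    · subst h
      simp only [if_true, Function.update_self, Function.update_idem]
      rw [hD u v, MultilinearMap.map_update_add, MultilinearMap.map_update_sum]
    · rw [if_neg h, zero_add, Function.update_of_ne h, Function.update_of_ne (Ne.symm h),
        ← hαL, ← hαL, Function.update_comm h]
  intro x y z
  induction x using PiTensorProduct.induction_on with
  | add x₁ x₂ h₁ h₂ => simp only [map_add, LinearMap.add_apply, h₁, h₂]; abel
  | smul_tprod r u =>
    induction y using PiTensorProduct.induction_on with
    | add x₁ x₂ h₁ h₂ => simp only [map_add, LinearMap.add_apply, h₁, h₂]; abel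
    | smul_tprod s v =>
      induction z using PiTensorProduct.induction_on with
      | add x₁ x₂ h₁ h₂ => simp only [map_add, h₁, h₂]; abel
      | smul_tprod t w =>
        simp only [map_smul, LinearMap.smul_apply, key u v w, smul_add]
        simp only [smul_smul]
        congr 2 <;> ring
end

section
/- Let (N, [·,...,·], α) be an n-ary multiplicative Hom-Nambu-Lie algebra, let φ: Nⁿ → K be a skew-symmetric n-linear map and λ: N → K a linear map. On the central extension Ñ = N ⊕ K·e define the skew-symmetric n-linear bracket [x₁ + a₁e, ..., xₙ + aₙe]~ = [x₁,...,xₙ] + φ(x₁,...,xₙ)e (so the bracket vanishes whenever one argument is e) and the linear map β(x + ae) = α(x) + λ(x)e. Then (Ñ, [·,...,·]~, β) satisfies the Hom-Nambu identity if and only if φ(α(x₁),...,α(x_{n−1}),[y₁,...,yₙ]) = Σ_{i=1}^{n} φ(α(y₁),...,α(y_{i−1}),[x₁,...,x_{n−1},yᵢ],α(y_{i+1}),...,α(yₙ)) for all xⱼ, yⱼ ∈ N. -/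
theorem fst_snoc_aux {A B : Type*} {n : ℕ} (u : Fin n → A × B) (p : A × B) :
    (fun i => ((Fin.snoc u p : Fin (n + 1) → A × B) i).1)
      = (Fin.snoc (fun j => (u j).1) p.1 : Fin (n + 1) → A) := by
  funext i
  refine Fin.lastCases ?_ (fun j => ?_) i
  · simp
  · simp

theorem fst_update_aux {A B : Type*} {n : ℕ} (v : Fin n → A × B) (i : Fin n) (p : A × B) :
    (fun j => (Function.update v i p j).1)
      = Function.update (fun j => (v j).1) i p.1 := by
  funext j
  by_cases h : j = i
  · subst h; simp
  · simp [h]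

/-- Let `(N, br, α)` be an `(n+1)`-ary multiplicative Hom-Nambu-Lie algebra,
`φ : N^{n+1} → K` a skew-symmetric multilinear map and `lam : N → K` a linear map.  On the
central extension `Ñ = N ⊕ K·e` (modelled as `N × K`, with `e = (0,1)`) define the bracket
`[x₁+a₁e,...,x_{n+1}+a_{n+1}e]~ = [x₁,...,x_{n+1}] + φ(x₁,...,x_{n+1}) e` (so it vanishes
whenever one argument is `e`) and the map `β(x+ae) = α(x) + lam(x) e`.  Then `(Ñ, [·,...,·]~, β)`
satisfies the Hom-Nambu identity iff `φ` satisfies the 1-cocycle condition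
`φ(α x₁,...,α xₙ,[y₁,...,y_{n+1}]) = Σᵢ φ(α y₁,...,[x₁,...,xₙ,yᵢ],...,α y_{n+1})`. -/
theorem central_extension_homNambu_iff_cocycle
    {K N : Type*} [Field K] [CharZero K] [AddCommGroup N] [Module K N] (n : ℕ)
    (br : AlternatingMap K N N (Fin (n + 1))) (α : N →ₗ[K] N)
    (hmult : ∀ v : Fin (n + 1) → N, α (br v) = br (fun i => α (v i)))
    (hNambu : ∀ (x : Fin n → N) (y : Fin (n + 1) → N),
      br (Fin.snoc (fun j => α (x j)) (br y)) =
        ∑ i : Fin (n + 1),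
          br (Function.update (fun j => α (y j)) i (br (Fin.snoc x (y i)))))
    (φ : AlternatingMap K N K (Fin (n + 1))) (lam : N →ₗ[K] K) :
    (let brE : (Fin (n + 1) → N × K) → N × K :=
      fun u => (br (fun i => (u i).1), φ (fun i => (u i).1))
     let β : N × K → N × K := fun p => (α p.1, lam p.1)
     ∀ (u : Fin n → N × K) (v : Fin (n + 1) → N × K),
      brE (Fin.snoc (fun j => β (u j)) (brE v)) =
        ∑ i : Fin (n + 1),
          brE (Function.update (fun j => β (v j)) i (brE (Fin.snoc u (v i)))))
    ↔ (∀ (x : Fin n → N) (y : Fin (n + 1) → N),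
      φ (Fin.snoc (fun j => α (x j)) (br y)) =
        ∑ i : Fin (n + 1),
          φ (Function.update (fun j => α (y j)) i (br (Fin.snoc x (y i))))) := by
  constructor
  · intro h x y
    have h1 := congrArg Prod.snd (h (fun j => (x j, 0)) (fun j => (y j, 0)))
    simp only [Prod.snd_sum, fst_snoc_aux, fst_update_aux] at h1
    exact h1
  · intro h brE β u v
    refine Prod.ext ?_ ?_
    · simp only [brE, β, Prod.fst_sum, fst_snoc_aux, fst_update_aux]
      exact hNambu _ _
    · simp only [brE, β, Prod.snd_sum, fst_snoc_aux, fst_update_aux]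
      exact h _ _
end

section
/- Let (N, [·,...,·], α) be an n-ary multiplicative Hom-Nambu-Lie algebra and let φ ∈ C^p(N, K) be a p-cochain with values in K. Then δ^{p+1}(δ^p(φ)) = 0. -/
/-- The coboundary operator on `K`-valued `q`-cochains of an `(n+1)`-ary multiplicative
Hom-Nambu-Lie algebra (trivial coefficients):
`δφ(x₁,...,x_{q+1},z) = Σ_{i<j} (−1)^i φ(α̃x₁,...,x̂ᵢ,...,[xᵢ,xⱼ]_α,...,α̃x_{q+1},αz)
  + Σᵢ (−1)^i φ(α̃x₁,...,x̂ᵢ,...,α̃x_{q+1}, L(xᵢ)·z)`,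
where `L` is the fundamental linear map, `α̃` the induced twist and `[·,·]_α` the induced
Hom-Leibniz bracket on `L(N) = ⋀^n N`. -/
def deltaScalar {K N : Type*} [Field K] [AddCommGroup N] [Module K N] {n : ℕ}
    (α : N →ₗ[K] N) (Lop : ⋀[K]^n N →ₗ[K] N →ₗ[K] N)
    (αt : ⋀[K]^n N →ₗ[K] ⋀[K]^n N)
    (B : ⋀[K]^n N →ₗ[K] ⋀[K]^n N →ₗ[K] ⋀[K]^n N)
    {q : ℕ} (g : (Fin q → ⋀[K]^n N) → N → K) :
    (Fin (q + 1) → ⋀[K]^n N) → N → K :=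
  fun x z =>
    (∑ i : Fin (q + 1), ∑ j : Fin (q + 1),
      if i < j then
        (-1 : K) ^ ((i : ℕ) + 1) *
          g ((Function.update (fun l => αt (x l)) j (B (x i) (x j))) ∘ i.succAbove) (α z)
      else 0)
    + ∑ i : Fin (q + 1),
        (-1 : K) ^ ((i : ℕ) + 1) * g ((fun l => αt (x l)) ∘ i.succAbove) (Lop (x i) z)

namespace HomNambuAux

/-- Additivity in each slot. -/
def MAdd {M A : Type*} [AddCommGroup M] [AddCommGroup A] {m : ℕ}
    (F : (Fin m → M) → A) : Prop :=
  ∀ (y : Fin m → M) (j : Fin m) (a b : M),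
    F (Function.update y j (a + b)) = F (Function.update y j a) + F (Function.update y j b)

/-- Lie-derivative type operator. -/
def th {M A : Type*} [AddCommGroup A] (a f : M → M) {m : ℕ}
    (F : (Fin m → M) → A) (y : Fin m → M) : A :=
  ∑ j, F (Function.update (fun l => a (y l)) j (f (y j)))

/-- Partial evaluation in the first slot. -/
def ev {M A : Type*} {m : ℕ} (F : (Fin (m + 1) → M) → A) (u : M) : (Fin m → M) → A :=
  fun y => F (Fin.cons u y)

theorem MAdd.ev {M A : Type*} [AddCommGroup M] [AddCommGroup A] {m : ℕ}
    {F : (Fin (m + 1) → M) → A} (hF : MAdd F) (u : M) : MAdd (ev F u) := by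
  intro y j a b
  simp only [HomNambuAux.ev, Fin.cons_update]
  exact hF _ _ _ _

theorem MAdd.cons {M A : Type*} [AddCommGroup M] [AddCommGroup A] {m : ℕ}
    {F : (Fin (m + 1) → M) → A} (hF : MAdd F) (u v : M) (y : Fin m → M) :
    F (Fin.cons (u + v) y) = F (Fin.cons u y) + F (Fin.cons v y) := by
  have := hF (Fin.cons 0 y) 0 u v
  simpa only [Fin.update_cons_zero] using this

theorem comp_cons {M : Type*} (a : M → M) {m : ℕ} (u : M) (y : Fin m → M) :
    (fun l => a ((Fin.cons u y : Fin (m + 1) → M) l)) = Fin.cons (a u) (fun l => a (y l)) := by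
  funext l
  refine Fin.cases ?_ (fun l => ?_) l <;> simp

theorem th_cons {M A : Type*} [AddCommGroup A] (a f : M → M) {m : ℕ}
    (F : (Fin (m + 1) → M) → A) (u : M) (y : Fin m → M) :
    th a f F (Fin.cons u y) = F (Fin.cons (f u) (fun l => a (y l))) + th a f (ev F (a u)) y := by
  simp only [th, Fin.sum_univ_succ, comp_cons, Fin.cons_zero, Fin.cons_succ,
    Fin.update_cons_zero, ev, Fin.cons_update]

theorem th_comp {M A : Type*} [AddCommGroup A] (a f f' : M → M)
    (h : ∀ v, a (f v) = f' (a v)) {m : ℕ}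
    (F : (Fin m → M) → A) (y : Fin m → M) :
    th a f (fun y => F (fun l => a (y l))) y = th a f' F (fun l => a (y l)) := by
  simp only [th]
  refine Finset.sum_congr rfl fun j _ => congrArg F ?_
  funext l
  by_cases hl : l = j
  · subst hl; simp [h]
  · simp [hl]

theorem th_add {M A : Type*} [AddCommGroup A] (a f : M → M) {m : ℕ}
    (F G : (Fin m → M) → A) (y : Fin m → M) :
    th a f (fun y => F y + G y) y = th a f F y + th a f G y := by
  simp [th, Finset.sum_add_distrib]

theorem th_neg {M A : Type*} [AddCommGroup A] (a f : M → M) {m : ℕ}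
    (F : (Fin m → M) → A) (y : Fin m → M) :
    th a f (fun y => - F y) y = - th a f F y := by
  simp [th]

theorem ev_th {M A : Type*} [AddCommGroup A] (a f : M → M) {m : ℕ}
    (F : (Fin (m + 1) → M) → A) (u : M) :
    ev (th a f F) u = fun y => ev F (f u) (fun l => a (y l)) + th a f (ev F (a u)) y := by
  funext y
  exact th_cons a f F u y

theorem th_comm {M A : Type*} [AddCommGroup M] [AddCommGroup A]
    (a fx fu fax fau fxu : M → M)
    (hx : ∀ v, a (fx v) = fax (a v)) (hu : ∀ v, a (fu v) = fau (a v))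
    (hL : ∀ v, fax (fu v) = fxu (a v) + fau (fx v)) {m : ℕ} (F : (Fin m → M) → A)
    (hF : MAdd F) (y : Fin m → M) :
    th a fxu F (fun l => a (y l)) + th a fx (th a fau F) y = th a fu (th a fax F) y := by
  induction m with
  | zero => simp [th]
  | succ m ih =>
    induction y using Fin.consCases with
    | _ v y =>
    rw [comp_cons, th_cons, th_cons a fx, th_cons a fu, ev_th, ev_th, th_add, th_add,
      th_cons a fau, th_cons a fax, hL, hF.cons, th_comp a fx fax hx, th_comp a fu fau hu,
      ← ih _ ((hF.ev _)), hx, hu]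
    abel

/-- The Leibniz coboundary with trivial coefficients. -/
def D {M K : Type*} [Field K] (a : M → M) (b : M → M → M) {m : ℕ}
    (F : (Fin m → M) → K) (y : Fin (m + 1) → M) : K :=
  ∑ i : Fin (m + 1), ∑ j : Fin (m + 1),
      if i < j then
        (-1 : K) ^ ((i : ℕ) + 1) *
          F ((Function.update (fun l => a (y l)) j (b (y i) (y j))) ∘ i.succAbove)
      else 0

theorem D_cons {M K : Type*} [Field K] (a : M → M) (b : M → M → M) {m : ℕ}
    (F : (Fin (m + 1) → M) → K) (x : M) (y : Fin (m + 1) → M) :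
    D a b F (Fin.cons x y) = - th a (b x) F y - D a b (ev F (a x)) y := by
  unfold D
  rw [Fin.sum_univ_succ, sub_eq_add_neg]
  congr 1
  · rw [Fin.sum_univ_succ]
    simp only [lt_self_iff_false, if_false, zero_add, Fin.succ_pos, if_true, th,
      ← Finset.sum_neg_distrib, Fin.cons_zero, Fin.cons_succ, comp_cons, ← Fin.cons_update]
    refine Finset.sum_congr rfl fun j _ => ?_
    simp only [Fin.val_zero, zero_add, pow_one, neg_mul, one_mul, Fin.succAbove_zero]
    rfl
  · rw [← Finset.sum_neg_distrib]
    refine Finset.sum_congr rfl fun i _ => ?_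
    rw [Fin.sum_univ_succ, ← Finset.sum_neg_distrib]
    simp only [Fin.not_lt_zero, if_false, zero_add]
    refine Finset.sum_congr rfl fun j _ => ?_
    simp only [Fin.succ_lt_succ_iff, Fin.cons_succ, comp_cons, ← Fin.cons_update]
    split_ifs with h
    · have : (Fin.cons (a x) (Function.update (fun l => a (y l)) j (b (y i) (y j))) :
          Fin (m + 2) → M) ∘ i.succ.succAbove
          = Fin.cons (a x) ((Function.update (fun l => a (y l)) j (b (y i) (y j)))
            ∘ i.succAbove) := by
        generalize Function.update (fun l => a (y l)) j (b (y i) (y j)) = Y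
        funext l
        refine Fin.cases ?_ (fun l => ?_) l <;> simp
      rw [this, ev, Fin.val_succ, pow_succ]
      ring
    · simp

theorem D_add {M K : Type*} [Field K] (a : M → M) (b : M → M → M) {m : ℕ}
    (F G : (Fin m → M) → K) (y : Fin (m + 1) → M) :
    D a b (fun y => F y + G y) y = D a b F y + D a b G y := by
  simp only [D, ← Finset.sum_add_distrib]
  refine Finset.sum_congr rfl fun i _ => Finset.sum_congr rfl fun j _ => ?_
  split_ifs <;> ring

theorem D_neg {M K : Type*} [Field K] (a : M → M) (b : M → M → M) {m : ℕ}
    (F : (Fin m → M) → K) (y : Fin (m + 1) → M) :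
    D a b (fun y => - F y) y = - D a b F y := by
  simp only [D, ← Finset.sum_neg_distrib]
  refine Finset.sum_congr rfl fun i _ => Finset.sum_congr rfl fun j _ => ?_
  split_ifs <;> ring

theorem D_comp {M K : Type*} [Field K] (a : M → M) (b : M → M → M)
    (hab : ∀ u v, a (b u v) = b (a u) (a v)) {m : ℕ}
    (F : (Fin m → M) → K) (y : Fin (m + 1) → M) :
    D a b (fun y => F (fun l => a (y l))) y = D a b F (fun l => a (y l)) := by
  simp only [D]
  refine Finset.sum_congr rfl fun i _ => Finset.sum_congr rfl fun j _ => ?_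
  split_ifs
  · congr 2
    funext l
    by_cases hl : i.succAbove l = j
    · simp [hl, hab]
    · simp [hl]
  · rfl

theorem D_zero {M K : Type*} [Field K] (a : M → M) (b : M → M → M)
    (F : (Fin 0 → M) → K) (y : Fin 1 → M) : D a b F y = 0 := by
  simp [D]

theorem ev_D {M K : Type*} [Field K] (a : M → M) (b : M → M → M) {m : ℕ}
    (F : (Fin (m + 1) → M) → K) (x : M) :
    ev (D a b F) x = fun y => - th a (b x) F y + - D a b (ev F (a x)) y := by
  funext y
  rw [← sub_eq_add_neg]
  exact D_cons a b F x y

theorem th_D {M K : Type*} [AddCommGroup M] [Field K] (a : M → M) (b : M → M → M)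
    (hab : ∀ u v, a (b u v) = b (a u) (a v))
    (hL : ∀ x u v, b (a x) (b u v) = b (b x u) (a v) + b (a u) (b x v)) {m : ℕ}
    (F : (Fin m → M) → K) (hF : MAdd F) (x : M) (y : Fin (m + 1) → M) :
    th a (b x) (D a b F) y = D a b (th a (b (a x)) F) y := by
  induction m with
  | zero => simp [D_zero, th]
  | succ m ih =>
    induction y using Fin.consCases with
    | _ u y =>
    rw [th_cons, D_cons, D_cons, ev_D, ev_th, th_add, th_neg, th_neg, D_add,
      ih _ (hF.ev _), D_comp a b hab,
      ← th_comm a (b x) (b u) (b (a x)) (b (a u)) (b (b x u)) (hab x) (hab u) (hL x u) F hF y,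
      hab]
    ring

theorem D_D {M K : Type*} [AddCommGroup M] [Field K] (a : M → M) (b : M → M → M)
    (hab : ∀ u v, a (b u v) = b (a u) (a v))
    (hL : ∀ x u v, b (a x) (b u v) = b (b x u) (a v) + b (a u) (b x v)) {m : ℕ}
    (F : (Fin m → M) → K) (hF : MAdd F) (y : Fin (m + 2) → M) :
    D a b (D a b F) y = 0 := by
  induction m with
  | zero =>
    have : D a b F = fun _ => 0 := by funext y; exact D_zero a b F y
    rw [this]; simp [D]
  | succ m ih =>
    induction y using Fin.consCases with
    | _ u y =>
    rw [D_cons, ev_D, D_add, D_neg, D_neg, ih _ (hF.ev _), th_D a b hab hL F hF]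
    ring

theorem wedge_induction {K N : Type*} [Field K] [AddCommGroup N] [Module K N] {n : ℕ}
    {p : ⋀[K]^n N → Prop} (x : ⋀[K]^n N) (hg : ∀ v, p (wedgeGen K n v)) (h0 : p 0)
    (ha : ∀ x y, p x → p y → p (x + y)) (hs : ∀ (c : K) x, p x → p (c • x)) : p x := by
  have hx : x ∈ Submodule.span K (Set.range (exteriorPower.ιMulti K n (M := N))) := by
    rw [exteriorPower.ιMulti_span]; trivial
  induction hx using Submodule.span_induction with
  | mem x h => obtain ⟨v, rfl⟩ := h; exact hg v
  | zero => exact h0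
  | add x y _ _ hx hy => exact ha x y hx hy
  | smul c x _ hx => exact hs c x hx

theorem wedge_madd {K N : Type*} [Field K] [AddCommGroup N] [Module K N] {n : ℕ} :
    MAdd (wedgeGen K n : (Fin n → N) → ⋀[K]^n N) := fun y j a b =>
  (exteriorPower.ιMulti K n (M := N)).map_update_add y j a b

theorem wedge_smul {K N : Type*} [Field K] [AddCommGroup N] [Module K N] {n : ℕ}
    (y : Fin n → N) (j : Fin n) (c : K) (a : N) :
    wedgeGen K n (Function.update y j (c • a)) = c • wedgeGen K n (Function.update y j a) :=
  (exteriorPower.ιMulti K n (M := N)).map_update_smul y j c a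

/-- Cochain seen on `L(N) × N`. -/
def hat {L N K : Type*} {q : ℕ} (g : (Fin q → L) → N → K) (y : Fin (q + 1) → L × N) : K :=
  g (fun i => (y i.castSucc).1) (y (Fin.last q)).2

theorem hat_delta {K N : Type*} [Field K] [AddCommGroup N] [Module K N] {n : ℕ}
    (α : N →ₗ[K] N) (Lop : ⋀[K]^n N →ₗ[K] N →ₗ[K] N)
    (αt : ⋀[K]^n N →ₗ[K] ⋀[K]^n N)
    (B : ⋀[K]^n N →ₗ[K] ⋀[K]^n N →ₗ[K] ⋀[K]^n N)
    {q : ℕ} (g : (Fin q → ⋀[K]^n N) → N → K) :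
    hat (deltaScalar α Lop αt B g) =
      D (fun u => (αt u.1, α u.2)) (fun u v => (B u.1 v.1, Lop u.1 v.2)) (hat g) := by
  funext y
  simp only [hat, deltaScalar, D]
  rw [← Finset.sum_add_distrib]
  conv_rhs => rw [Fin.sum_univ_castSucc]
  have h0 : ∀ j : Fin (q + 2), ¬ (Fin.last (q + 1) < j) := fun j => not_lt.2 (Fin.le_last j)
  simp only [h0, if_false, Finset.sum_const_zero, add_zero]
  refine Finset.sum_congr rfl fun i _ => ?_
  conv_rhs => rw [Fin.sum_univ_castSucc]
  congr 1
  · refine Finset.sum_congr rfl fun j _ => ?_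
    simp only [Fin.castSucc_lt_castSucc_iff]
    split_ifs
    · simp only [Fin.val_castSucc]
      congr 2
      · funext l
        simp only [Function.comp, Fin.castSucc_succAbove_castSucc]
        by_cases hl : i.succAbove l = j
        · simp [hl]
        · simp [hl]
      · simp [Function.update_of_ne (Fin.castSucc_lt_last j).ne']
    · rfl
  · simp only [Fin.castSucc_lt_last, if_true, Fin.val_castSucc]
    congr 2
    · funext l
      simp [Function.update_of_ne (Fin.castSucc_lt_last _).ne]
    · simp

end HomNambuAux

/-- Let `(N, br, α)` be an `(n+1)`-ary multiplicative Hom-Nambu-Lie algebra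
and let `φ ∈ C^p(N, K)` be a `p`-cochain with values in `K`: a multilinear map
`L(N)^{⊗p} ⊗ N → K` (with `L(N) = ⋀^n N`) which is alternating in its last `n+1` arguments.
Then `δ^{p+1}(δ^p(φ)) = 0`. -/
theorem scalar_coboundary_squared_zero
    {K N : Type*} [Field K] [CharZero K] [AddCommGroup N] [Module K N] (n : ℕ)
    (br : AlternatingMap K N N (Fin (n + 1))) (α : N →ₗ[K] N)
    (hmult : ∀ v : Fin (n + 1) → N, α (br v) = br (fun i => α (v i)))
    (hNambu : ∀ (x : Fin n → N) (y : Fin (n + 1) → N),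
      br (Fin.snoc (fun j => α (x j)) (br y)) =
        ∑ i : Fin (n + 1),
          br (Function.update (fun j => α (y j)) i (br (Fin.snoc x (y i)))))
    (Lop : ⋀[K]^n N →ₗ[K] N →ₗ[K] N)
    (hLop : ∀ (v : Fin n → N) (z : N), Lop (wedgeGen K n v) z = br (Fin.snoc v z))
    (αt : ⋀[K]^n N →ₗ[K] ⋀[K]^n N)
    (hαt : ∀ v : Fin n → N, αt (wedgeGen K n v) = wedgeGen K n (fun i => α (v i)))
    (B : ⋀[K]^n N →ₗ[K] ⋀[K]^n N →ₗ[K] ⋀[K]^n N)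
    (hB : ∀ v w : Fin n → N,
      B (wedgeGen K n v) (wedgeGen K n w) =
        ∑ i : Fin n,
          wedgeGen K n (Function.update (fun j => α (w j)) i (br (Fin.snoc v (w i)))))
    (p : ℕ) (φ : MultilinearMap K (fun _ : Fin p => ⋀[K]^n N) (N →ₗ[K] K))
    (hwedge : ∀ (x : Fin p → ⋀[K]^n N) (j : Fin p), (j : ℕ) + 1 = p →
      ∀ (v : Fin n → N) (i : Fin n), φ (Function.update x j (wedgeGen K n v)) (v i) = 0) :
    ∀ (x : Fin (p + 2) → ⋀[K]^n N) (z : N),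
      deltaScalar α Lop αt B (deltaScalar α Lop αt B (fun a w => φ a w)) x z = 0 := by
  classical
  have hα : ∀ x z, α (Lop x z) = Lop (αt x) (α z) := by
    intro x z
    induction x using HomNambuAux.wedge_induction with
    | hg v =>
      rw [hLop, hαt, hLop, hmult]
      congr 1
      funext i
      refine Fin.lastCases ?_ (fun i => ?_) i <;> simp
    | h0 => simp
    | ha x y hx hy => simp [hx, hy]
    | hs c x hx => simp [hx]
  have hBth : ∀ X w, B X (wedgeGen K n w) = HomNambuAux.th α (Lop X) (wedgeGen K n) w := by
    intro X w
    induction X using HomNambuAux.wedge_induction with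
    | hg v => simp only [hB, HomNambuAux.th, hLop]
    | h0 =>
      simp only [map_zero, LinearMap.zero_apply, HomNambuAux.th]
      refine (Finset.sum_eq_zero fun j _ => ?_).symm
      have := HomNambuAux.wedge_smul (K := K) (fun l => α (w l)) j 0 0
      simpa using this
    | ha x y hx hy =>
      simp only [map_add, LinearMap.add_apply, hx, hy, HomNambuAux.th,
        ← Finset.sum_add_distrib]
      exact Finset.sum_congr rfl fun j _ => (HomNambuAux.wedge_madd _ _ _ _).symm
    | hs c x hx =>
      simp only [map_smul, LinearMap.smul_apply, hx, HomNambuAux.th, Finset.smul_sum]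
      exact Finset.sum_congr rfl fun j _ => (HomNambuAux.wedge_smul _ _ _ _).symm
  have hC : ∀ x y z, Lop (αt x) (Lop y z) = Lop (B x y) (α z) + Lop (αt y) (Lop x z) := by
    intro x y z
    induction x using HomNambuAux.wedge_induction with
    | hg v =>
      induction y using HomNambuAux.wedge_induction with
      | hg w =>
        rw [hαt, hLop, hLop, hNambu, Fin.sum_univ_castSucc, hB, hαt, map_sum,
          LinearMap.sum_apply, hLop, hLop]
        congr 1
        · refine Finset.sum_congr rfl fun i _ => ?_
          rw [hLop]
          congr 1
          funext l
          refine Fin.lastCases ?_ (fun l => ?_) l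
          · simp [Function.update_of_ne (Fin.castSucc_lt_last i).ne']
          · by_cases hl : l = i
            · subst hl; simp
            · simp [hl]
        · congr 1
          funext l
          refine Fin.lastCases ?_ (fun l => ?_) l
          · simp
          · simp [Function.update_of_ne (Fin.castSucc_lt_last l).ne]
      | h0 => simp
      | ha x y hx hy => simp only [map_add, LinearMap.add_apply, hx, hy]; abel
      | hs c x hx => simp only [map_smul, LinearMap.smul_apply, hx, smul_add]
    | h0 => simp
    | ha x y hx hy => simp only [map_add, LinearMap.add_apply, hx, hy]; abel
    | hs c x hx => simp only [map_smul, LinearMap.smul_apply, hx, smul_add]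
  have hBα : ∀ x y, αt (B x y) = B (αt x) (αt y) := by
    intro x y
    induction y using HomNambuAux.wedge_induction with
    | hg w =>
      rw [hαt, hBth, hBth, ← HomNambuAux.th_comp α (Lop x) (Lop (αt x)) (hα x)]
      simp only [HomNambuAux.th, map_sum, hαt]
    | h0 => simp
    | ha x y hx hy => simp only [map_add, hx, hy]
    | hs c x hx => simp only [map_smul, hx]
  have hBB : ∀ x u v, B (αt x) (B u v) = B (B x u) (αt v) + B (αt u) (B x v) := by
    intro x u v
    induction v using HomNambuAux.wedge_induction with
    | hg w =>
      have key := HomNambuAux.th_comm α (Lop x) (Lop u) (Lop (αt x)) (Lop (αt u)) (Lop (B x u))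
        (hα x) (hα u) (hC x u) (wedgeGen K n) HomNambuAux.wedge_madd w
      have h2 : ∀ s t, B s (B t (wedgeGen K n w)) =
          HomNambuAux.th α (Lop t) (HomNambuAux.th α (Lop s) (wedgeGen K n)) w := by
        intro s t
        rw [hBth t]
        conv_lhs => unfold HomNambuAux.th
        rw [map_sum]
        simp only [hBth]
        rfl
      rw [h2, h2, hαt, hBth, key]
    | h0 => simp
    | ha x y hx hy => simp only [map_add, hx, hy]; abel
    | hs c x hx => simp only [map_smul, hx, smul_add]
  intro x z
  have hF : HomNambuAux.MAdd (HomNambuAux.hat (fun a w => φ a w)) := by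
    intro y j a b
    simp only [HomNambuAux.hat]
    refine Fin.lastCases ?_ (fun j => ?_) j
    · have : ∀ (c : ⋀[K]^n N × N) (i : Fin p),
          Function.update y (Fin.last p) c i.castSucc = y i.castSucc := fun c i =>
        Function.update_of_ne (Fin.castSucc_lt_last i).ne _ _
      simp [this]
    · have h1 : ∀ c : ⋀[K]^n N × N, (fun i : Fin p => (Function.update y j.castSucc c i.castSucc).1)
          = Function.update (fun i : Fin p => (y i.castSucc).1) j c.1 := by
        intro c
        funext l
        by_cases hl : l = j
        · subst hl; simp
        · simp [hl]
      have h2 : ∀ c : ⋀[K]^n N × N, Function.update y j.castSucc c (Fin.last p) = y (Fin.last p) :=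
        fun c => Function.update_of_ne (Fin.castSucc_lt_last j).ne' _ _
      simp [h1, h2]
  have main := HomNambuAux.D_D (fun u : ⋀[K]^n N × N => (αt u.1, α u.2))
    (fun u v => (B u.1 v.1, Lop u.1 v.2))
    (fun u v => by simp [hα, hBα])
    (fun x u v => by simp [← hBB, ← hC])
    _ hF (Fin.snoc (fun i => (x i, 0)) (0, z))
  rw [← HomNambuAux.hat_delta, ← HomNambuAux.hat_delta] at main
  simpa [HomNambuAux.hat] using main
end

section
/- Let (N, [·,...,·], α) be an n-ary multiplicative Hom-Nambu-Lie algebra and let ψ ∈ C^p(N, N) be a p-cochain with values in N. Then δ^{p+1}(δ^p(ψ)) = 0. -/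
/-- The value of the coboundary `δ^q g` of an `N`-valued `q`-cochain `g` of an `(n+1)`-ary
multiplicative Hom-Nambu-Lie algebra `(N, br, α)` on a tuple of generators
`x_j = v j 0 ∧ ... ∧ v j (n-1)` of `L(N) = ⋀^n N` and `z ∈ N`:
`δ^q g(x₁,...,x_{q+1},z) = Σ_{i<j} (−1)^i g(α̃x₁,...,x̂ᵢ,...,[xᵢ,xⱼ]_α,...,α̃x_{q+1},αz)
 + Σᵢ (−1)^i g(α̃x₁,...,x̂ᵢ,...,α̃x_{q+1}, L(xᵢ)·z)
 + Σᵢ (−1)^{i+1} L(α̃^q xᵢ)·g(x₁,...,x̂ᵢ,...,x_{q+1},z)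
 + (−1)^q Σᵢ [α^q(v_{q+1} 1),...,g(x₁,...,x_q, v_{q+1} i),...,α^q(v_{q+1} (n-1)), α^q z]`,
where `Lop`, `αt`, `B` are the fundamental map, twist and Hom-Leibniz bracket on `⋀^n N`. -/
def nambuDeltaOnGen {K N : Type*} [Field K] [AddCommGroup N] [Module K N] {n : ℕ}
    (br : AlternatingMap K N N (Fin (n + 1))) (α : N →ₗ[K] N)
    (Lop : ⋀[K]^n N →ₗ[K] N →ₗ[K] N)
    (αt : ⋀[K]^n N →ₗ[K] ⋀[K]^n N)
    (B : ⋀[K]^n N →ₗ[K] ⋀[K]^n N →ₗ[K] ⋀[K]^n N)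
    {q : ℕ} (g : (Fin q → ⋀[K]^n N) → N → N)
    (v : Fin (q + 1) → Fin n → N) (z : N) : N :=
  let a : Fin (q + 1) → ⋀[K]^n N := fun j => wedgeGen K n (v j)
  (∑ i : Fin (q + 1), ∑ j : Fin (q + 1),
    if i < j then
      ((-1 : ℤ) ^ ((i : ℕ) + 1)) •
        g ((Function.update (fun l => αt (a l)) j (B (a i) (a j))) ∘ i.succAbove) (α z)
    else 0)
  + ∑ i : Fin (q + 1),
      ((-1 : ℤ) ^ ((i : ℕ) + 1)) • g ((fun l => αt (a l)) ∘ i.succAbove) (Lop (a i) z)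
  + ∑ i : Fin (q + 1),
      ((-1 : ℤ) ^ (i : ℕ)) • Lop ((αt ^ q) (a i)) (g (a ∘ i.succAbove) z)
  + ((-1 : ℤ) ^ q) •
      ∑ i : Fin n,
        br (Fin.snoc
          (Function.update (fun s => (α ^ q) (v (Fin.last q) s)) i
            (g (fun j : Fin q => wedgeGen K n (v j.castSucc)) (v (Fin.last q) i)))
          ((α ^ q) z))


namespace NambuAux

section ListPart
set_option linter.unusedSectionVars false
set_option linter.unusedSimpArgs false
variable {K L N : Type*} [Field K] [AddCommGroup L] [Module K L] [AddCommGroup N] [Module K N]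

/-- Cochains as functions on lists. -/
abbrev Co (K L N : Type*) [Field K] [AddCommGroup N] [Module K N] := List L → Module.End K N

/-- Insertion of a first argument. -/
def ins (K : Type*) {L N : Type*} [Field K] [AddCommGroup N] [Module K N] (x : L) :
    Co K L N →ₗ[K] Co K L N where
  toFun ψ := fun l => ψ (x :: l)
  map_add' _ _ := rfl
  map_smul' _ _ := rfl

/-- Twisting all arguments. -/
def tw (σ : L →ₗ[K] L) (a : Module.End K N) : Co K L N →ₗ[K] Co K L N where
  toFun ψ := fun l => ψ (l.map σ) * a
  map_add' _ _ := by ext; simp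
  map_smul' _ _ := by ext; simp

/-- Postcomposition. -/
def post (L : Type*) {K N : Type*} [Field K] [AddCommGroup N] [Module K N] (T : Module.End K N) :
    Co K L N →ₗ[K] Co K L N where
  toFun ψ := fun l => T * ψ l
  map_add' _ _ := by ext; simp
  map_smul' _ _ := by ext; simp

/-- Cochain concentrated on the empty list. -/
def ee (L : Type*) {K N : Type*} [Field K] [AddCommGroup N] [Module K N] :
    Module.End K N →ₗ[K] Co K L N where
  toFun T := fun l => match l with
    | [] => T
    | _ :: _ => 0
  map_add' _ _ := by ext l; cases l <;> simp
  map_smul' _ _ := by ext l; cases l <;> simp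

def thRaw (σ : L →ₗ[K] L) (a : Module.End K N) (ℓ : L →ₗ[K] Module.End K N)
    (B : L →ₗ[K] L →ₗ[K] L) (x : L) : List L → Co K L N → Module.End K N
  | [], ψ => ψ [] * ℓ x
  | y :: l, ψ => thRaw σ a ℓ B x l (ins K (σ y) ψ) + tw σ a (ins K (B x y) ψ) l

def th (σ : L →ₗ[K] L) (a : Module.End K N) (ℓ : L →ₗ[K] Module.End K N)
    (B : L →ₗ[K] L →ₗ[K] L) (x : L) : Co K L N →ₗ[K] Co K L N where
  toFun ψ := fun l => thRaw σ a ℓ B x l ψ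
  map_add' f g := by
    funext l
    induction l generalizing f g with
    | nil => simp [thRaw, add_mul]
    | cons y l ih =>
      simp only [Pi.add_apply] at ih
      simp only [thRaw, Pi.add_apply, map_add, ih]; abel
  map_smul' c f := by
    funext l
    induction l generalizing f with
    | nil => simp [thRaw]
    | cons y l ih =>
      simp only [Pi.smul_apply, RingHom.id_apply] at ih
      simp only [thRaw, Pi.smul_apply, map_smul, ih, RingHom.id_apply, smul_add]

def d1Raw (σ : L →ₗ[K] L) (a : Module.End K N) (ℓ : L →ₗ[K] Module.End K N)
    (B : L →ₗ[K] L →ₗ[K] L) : List L → Co K L N → Module.End K N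
  | [], _ => 0
  | x :: l, ψ => - th σ a ℓ B x ψ l - d1Raw σ a ℓ B l (ins K (σ x) ψ)

def d1 (σ : L →ₗ[K] L) (a : Module.End K N) (ℓ : L →ₗ[K] Module.End K N)
    (B : L →ₗ[K] L →ₗ[K] L) : Co K L N →ₗ[K] Co K L N where
  toFun ψ := fun l => d1Raw σ a ℓ B l ψ
  map_add' f g := by
    funext l
    induction l generalizing f g with
    | nil => simp [d1Raw]
    | cons y l ih =>
      simp only [Pi.add_apply] at ih
      simp only [d1Raw, Pi.add_apply, map_add, ih]; abel
  map_smul' c f := by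
    funext l
    induction l generalizing f with
    | nil => simp [d1Raw]
    | cons y l ih =>
      simp only [Pi.smul_apply, RingHom.id_apply] at ih
      simp only [d1Raw, Pi.smul_apply, map_smul, ih, RingHom.id_apply, smul_sub, smul_neg]

def d2Raw (σ : L →ₗ[K] L) (a : Module.End K N) (ℓ : L →ₗ[K] Module.End K N)
    (D : ℕ → Module.End K N →ₗ[K] L →ₗ[K] L) (w : ℕ) : List L → Co K L N → Module.End K N
  | [], _ => 0
  | x :: l, ψ => post L (ℓ ((σ ^ w) x)) ψ l - d2Raw σ a ℓ D w l (ins K x ψ)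
      + ee L (ℓ (D w (ψ []) x) * a ^ w) l

def d2 (σ : L →ₗ[K] L) (a : Module.End K N) (ℓ : L →ₗ[K] Module.End K N)
    (D : ℕ → Module.End K N →ₗ[K] L →ₗ[K] L) (w : ℕ) : Co K L N →ₗ[K] Co K L N where
  toFun ψ := fun l => d2Raw σ a ℓ D w l ψ
  map_add' f g := by
    funext l
    induction l generalizing f g with
    | nil => simp [d2Raw]
    | cons y l ih =>
      simp only [Pi.add_apply] at ih
      simp only [d2Raw, Pi.add_apply, map_add, ih, LinearMap.add_apply, add_mul]; abel
  map_smul' c f := by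
    funext l
    induction l generalizing f with
    | nil => simp [d2Raw]
    | cons y l ih =>
      simp only [Pi.smul_apply, RingHom.id_apply] at ih
      simp only [d2Raw, Pi.smul_apply, map_smul, ih, RingHom.id_apply, LinearMap.smul_apply,
        smul_mul_assoc, smul_sub, smul_add]

def eRaw (σ : L →ₗ[K] L) (a : Module.End K N) (ℓ : L →ₗ[K] Module.End K N)
    (B : L →ₗ[K] L →ₗ[K] L) (D : ℕ → Module.End K N →ₗ[K] L →ₗ[K] L)
    (X : ℕ → Module.End K N → L → L → L) (w : ℕ) (x : L) : List L → Co K L N → Module.End K N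
  | [], _ => 0
  | y :: l, ψ => post L (ℓ ((σ ^ w) (B x y))) ψ l - eRaw σ a ℓ B D X w x l (ins K y ψ)
      + ee L (ℓ (D (w+1) (ψ []) y) * a ^ w * ℓ x + ℓ (X w (ψ []) x y) * a ^ (w+1)) l

def qRaw (σ : L →ₗ[K] L) (a : Module.End K N) (ℓ : L →ₗ[K] Module.End K N)
    (B : L →ₗ[K] L →ₗ[K] L) (D : ℕ → Module.End K N →ₗ[K] L →ₗ[K] L)
    (X : ℕ → Module.End K N → L → L → L) (w : ℕ) : List L → Co K L N → Module.End K N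
  | [], _ => 0
  | x :: l, ψ => eRaw σ a ℓ B D X w x l ψ + qRaw σ a ℓ B D X w l (ins K x ψ)
      + d1 σ a ℓ B (ee L (ℓ (D (w+1) (ψ []) x) * a ^ w)) l

/-- Multilinearity of a list cochain. -/
def ML (ψ : Co K L N) : Prop := ∀ l₁ l₂, IsLinearMap K (fun x => ψ (l₁ ++ x :: l₂))

theorem ML.ins {ψ : Co K L N} (h : ML ψ) (x : L) : ML (ins K x ψ) := fun l₁ l₂ => h (x :: l₁) l₂

theorem ML.ins_add {ψ : Co K L N} (h : ML ψ) (x y : L) :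
    NambuAux.ins K (x + y) ψ = NambuAux.ins K x ψ + NambuAux.ins K y ψ :=
  funext fun l => (h [] l).map_add x y

theorem ML.ins_smul {ψ : Co K L N} (h : ML ψ) (c : K) (x : L) :
    NambuAux.ins K (c • x) ψ = c • NambuAux.ins K x ψ :=
  funext fun l => (h [] l).map_smul c x

section
variable (σ : L →ₗ[K] L) (a : Module.End K N) (ℓ : L →ₗ[K] Module.End K N)
    (B : L →ₗ[K] L →ₗ[K] L) (D : ℕ → Module.End K N →ₗ[K] L →ₗ[K] L) (w : ℕ)

theorem th_c (x y : L) (ψ : Co K L N) (l : List L) :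
    th σ a ℓ B x ψ (y :: l) = ins K y (th σ a ℓ B x ψ) l := rfl
theorem d1_c (y : L) (ψ : Co K L N) (l : List L) :
    d1 σ a ℓ B ψ (y :: l) = ins K y (d1 σ a ℓ B ψ) l := rfl
theorem d2_c (y : L) (ψ : Co K L N) (l : List L) :
    d2 σ a ℓ D w ψ (y :: l) = ins K y (d2 σ a ℓ D w ψ) l := rfl
theorem tw_c (y : L) (ψ : Co K L N) (l : List L) :
    tw σ a ψ (y :: l) = ins K y (tw σ a ψ) l := rfl
theorem post_c (T : Module.End K N) (y : L) (ψ : Co K L N) (l : List L) :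
    post L T ψ (y :: l) = ins K y (post L T ψ) l := rfl
theorem ee_c (T : Module.End K N) (y : L) (l : List L) :
    ee L T (y :: l) = ins K y (ee L T) l := rfl

theorem th_nil (x : L) (ψ : Co K L N) : th σ a ℓ B x ψ [] = ψ [] * ℓ x := rfl
theorem d1_nil (ψ : Co K L N) : d1 σ a ℓ B ψ [] = 0 := rfl
theorem d2_nil (ψ : Co K L N) : d2 σ a ℓ D w ψ [] = 0 := rfl
theorem tw_nil (ψ : Co K L N) : tw σ a ψ [] = ψ [] * a := rfl
theorem post_nil (T : Module.End K N) (ψ : Co K L N) : post L T ψ [] = T * ψ [] := rfl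
theorem ee_nil (T : Module.End K N) : ee L T [] = T := rfl

theorem ins_th (x y : L) (ψ : Co K L N) : ins K y (th σ a ℓ B x ψ) =
    th σ a ℓ B x (ins K (σ y) ψ) + tw σ a (ins K (B x y) ψ) := rfl
theorem ins_d1 (x : L) (ψ : Co K L N) : ins K x (d1 σ a ℓ B ψ) =
    - th σ a ℓ B x ψ - d1 σ a ℓ B (ins K (σ x) ψ) := rfl
theorem ins_d2 (x : L) (ψ : Co K L N) : ins K x (d2 σ a ℓ D w ψ) =
    post L (ℓ ((σ ^ w) x)) ψ - d2 σ a ℓ D w (ins K x ψ) + ee L (ℓ (D w (ψ []) x) * a ^ w) := rfl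
theorem ins_tw (x : L) (ψ : Co K L N) : ins K x (tw σ a ψ) = tw σ a (ins K (σ x) ψ) := rfl
theorem ins_post (x : L) (T : Module.End K N) (ψ : Co K L N) :
    ins K x (post L T ψ) = post L T (ins K x ψ) := rfl
theorem ins_ee (x : L) (T : Module.End K N) : ins K x (ee L T) = 0 := rfl

theorem tw_post (T : Module.End K N) (ψ : Co K L N) :
    tw σ a (post L T ψ) = post L T (tw σ a ψ) := by
  funext l; simp [tw, post, mul_assoc]

theorem tw_ee (T : Module.End K N) : tw σ a (ee L T) = ee L (T * a) := by
  funext l; cases l <;> simp [tw, ee]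

theorem post_ee (S T : Module.End K N) : post L S (ee L T) = ee L (S * T) := by
  funext l; cases l <;> simp [post, ee]

theorem post_post (S T : Module.End K N) (ψ : Co K L N) :
    post L S (post L T ψ) = post L (S * T) ψ := by
  funext l; simp [post, mul_assoc]

theorem post_add (S T : Module.End K N) (ψ : Co K L N) :
    post L (S + T) ψ = post L S ψ + post L T ψ := by
  funext l; simp [post, add_mul]

theorem post_smul (c : K) (T : Module.End K N) (ψ : Co K L N) :
    post L (c • T) ψ = c • post L T ψ := by
  funext l; simp [post]

theorem th_ee (x : L) (T : Module.End K N) : th σ a ℓ B x (ee L T) = ee L (T * ℓ x) := by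
  funext l
  cases l with
  | nil => rfl
  | cons y l =>
    rw [th_c, ee_c, ins_th]
    simp [ins_ee]

theorem th_post (x : L) (T : Module.End K N) (ψ : Co K L N) :
    th σ a ℓ B x (post L T ψ) = post L T (th σ a ℓ B x ψ) := by
  funext l
  induction l generalizing ψ with
  | nil => simp [th_nil, post_nil, mul_assoc]
  | cons y l ih =>
    simp only [Pi.add_apply, th_c, d1_c, d2_c, tw_c, post_c, ee_c]
    rw [ins_post, ins_th, ins_th]
    simp only [ins_post, map_add, Pi.add_apply, ih, tw_post]

theorem d1_post (T : Module.End K N) (ψ : Co K L N) :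
    d1 σ a ℓ B (post L T ψ) = post L T (d1 σ a ℓ B ψ) := by
  funext l
  induction l generalizing ψ with
  | nil => simp [d1_nil, post_nil]
  | cons y l ih =>
    simp only [Pi.add_apply, th_c, d1_c, d2_c, tw_c, post_c, ee_c]
    rw [ins_post, ins_d1, ins_d1]
    simp only [ins_post, map_sub, map_neg, Pi.sub_apply, ih, th_post]

theorem tw_th
    (h2 : ∀ x, a * ℓ x = ℓ (σ x) * a)
    (h4 : ∀ x y, σ (B x y) = B (σ x) (σ y))
    (x : L) (ψ : Co K L N) :
    tw σ a (th σ a ℓ B (σ x) ψ) = th σ a ℓ B x (tw σ a ψ) := by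
  funext l
  induction l generalizing ψ with
  | nil => simp [th_nil, tw_nil, mul_assoc, h2]
  | cons y l ih =>
    simp only [Pi.add_apply, th_c, d1_c, d2_c, tw_c, post_c, ee_c]
    rw [ins_tw, ins_th, ins_th]
    simp only [ins_tw, map_add, Pi.add_apply, ih, h4]

theorem tw_d1
    (h2 : ∀ x, a * ℓ x = ℓ (σ x) * a)
    (h4 : ∀ x y, σ (B x y) = B (σ x) (σ y))
    (ψ : Co K L N) :
    tw σ a (d1 σ a ℓ B ψ) = d1 σ a ℓ B (tw σ a ψ) := by
  funext l
  induction l generalizing ψ with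
  | nil => simp [d1_nil, tw_nil]
  | cons y l ih =>
    simp only [Pi.add_apply, th_c, d1_c, d2_c, tw_c, post_c, ee_c]
    rw [ins_tw, ins_d1, ins_d1]
    simp only [ins_tw, map_sub, map_neg, Pi.sub_apply, ih, tw_th σ a ℓ B h2 h4]

theorem tw_d2
    (hD1 : ∀ w f x, D w f (σ x) = D (w + 1) (f * a) x)
    (ψ : Co K L N) :
    tw σ a (d2 σ a ℓ D w ψ) = d2 σ a ℓ D (w + 1) (tw σ a ψ) := by
  funext l
  induction l generalizing ψ with
  | nil => simp [d2_nil, tw_nil]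
  | cons y l ih =>
    simp only [Pi.add_apply, th_c, d1_c, d2_c, tw_c, post_c, ee_c]
    rw [ins_tw, ins_d2, ins_d2]
    simp only [ins_tw, map_sub, map_add, Pi.sub_apply, Pi.add_apply, ih, tw_post, tw_ee, hD1,
      tw_nil, pow_succ, Module.End.mul_apply, mul_assoc]

theorem th_th
    (h1 : ∀ x y, ℓ (σ x) * ℓ y = ℓ (B x y) * a + ℓ (σ y) * ℓ x)
    (h2 : ∀ x, a * ℓ x = ℓ (σ x) * a)
    (h3 : ∀ x y z, B (σ x) (B y z) = B (B x y) (σ z) + B (σ y) (B x z))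
    (h4 : ∀ x y, σ (B x y) = B (σ x) (σ y))
    (x y : L) (ψ : Co K L N) (hψ : ML ψ) :
    th σ a ℓ B y (th σ a ℓ B (σ x) ψ) =
      tw σ a (th σ a ℓ B (B x y) ψ) + th σ a ℓ B x (th σ a ℓ B (σ y) ψ) := by
  funext l
  induction l generalizing ψ with
  | nil => simp only [th_nil, tw_nil, mul_assoc, Pi.add_apply, ← mul_add, h1 x y]
  | cons z l ih =>
    simp only [Pi.add_apply, th_c, d1_c, d2_c, tw_c, post_c, ee_c]
    rw [ins_tw]
    simp only [ins_th, map_add, Pi.add_apply, ih _ ((hψ.ins _)), h3 x y z, hψ.ins_add, h4,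
      tw_th σ a ℓ B h2 h4]
    abel

theorem th_d1
    (h1 : ∀ x y, ℓ (σ x) * ℓ y = ℓ (B x y) * a + ℓ (σ y) * ℓ x)
    (h2 : ∀ x, a * ℓ x = ℓ (σ x) * a)
    (h3 : ∀ x y z, B (σ x) (B y z) = B (B x y) (σ z) + B (σ y) (B x z))
    (h4 : ∀ x y, σ (B x y) = B (σ x) (σ y))
    (x : L) (ψ : Co K L N) (hψ : ML ψ) :
    th σ a ℓ B x (d1 σ a ℓ B ψ) = d1 σ a ℓ B (th σ a ℓ B (σ x) ψ) := by
  funext l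
  induction l generalizing ψ with
  | nil => simp [th_nil, d1_nil]
  | cons z l ih =>
    simp only [Pi.add_apply, th_c, d1_c, d2_c, tw_c, post_c, ee_c]
    simp only [ins_th, ins_d1, map_sub, map_add, map_neg, Pi.add_apply, Pi.sub_apply, Pi.neg_apply,
      ih _ (hψ.ins _), h4, tw_d1 σ a ℓ B h2 h4,
      th_th σ a ℓ B h1 h2 h3 h4 x z ψ hψ]
    abel

theorem d1_d1
    (h1 : ∀ x y, ℓ (σ x) * ℓ y = ℓ (B x y) * a + ℓ (σ y) * ℓ x)
    (h2 : ∀ x, a * ℓ x = ℓ (σ x) * a)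
    (h3 : ∀ x y z, B (σ x) (B y z) = B (B x y) (σ z) + B (σ y) (B x z))
    (h4 : ∀ x y, σ (B x y) = B (σ x) (σ y))
    (ψ : Co K L N) (hψ : ML ψ) :
    d1 σ a ℓ B (d1 σ a ℓ B ψ) = 0 := by
  funext l
  induction l generalizing ψ with
  | nil => simp [d1_nil]
  | cons z l ih =>
    simp only [Pi.add_apply, th_c, d1_c, d2_c, tw_c, post_c, ee_c]
    simp only [ins_d1, map_sub, map_neg, Pi.sub_apply, Pi.neg_apply, ih _ (hψ.ins _),
      th_d1 σ a ℓ B h1 h2 h3 h4 z ψ hψ]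
    simp

theorem pow_ell
    (h2 : ∀ x, a * ℓ x = ℓ (σ x) * a)
    (x : L) : a ^ w * ℓ x = ℓ ((σ ^ w) x) * a ^ w := by
  induction w with
  | zero => simp
  | succ k ih => rw [pow_succ', mul_assoc, ih, ← mul_assoc, h2, pow_succ', mul_assoc]; rfl

theorem th_d2
    (h2 : ∀ x, a * ℓ x = ℓ (σ x) * a)
    (h4 : ∀ x y, σ (B x y) = B (σ x) (σ y))
    (X : ℕ → Module.End K N → L → L → L)
    (hD1 : ∀ w f x, D w f (σ x) = D (w + 1) (f * a) x)
    (hD3 : ∀ w f x y, D w f (B x y) = D (w + 1) (f * ℓ x) y + X w (f * a) x y)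
    (x : L) (ψ : Co K L N) (l : List L) :
    th σ a ℓ B x (d2 σ a ℓ D w ψ) l - d2 σ a ℓ D (w + 1) (th σ a ℓ B x ψ) l =
      eRaw σ a ℓ B D X w x l (tw σ a ψ) := by
  induction l generalizing ψ with
  | nil => simp [th_nil, d2_nil, eRaw]
  | cons y l ih =>
    simp only [Pi.add_apply, th_c, d1_c, d2_c, tw_c, post_c, ee_c]
    rw [eRaw]
    simp only [ins_tw, ← ih]
    simp only [ins_th, ins_d2, map_sub, map_add, Pi.sub_apply, Pi.add_apply, th_post, tw_post,
      tw_d2 σ a ℓ D w hD1, th_ee, tw_ee, th_nil, tw_nil, hD3, hD1, add_mul, pow_succ,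
      Module.End.mul_apply, mul_assoc]
    abel

theorem d1_d2
    (h2 : ∀ x, a * ℓ x = ℓ (σ x) * a)
    (h4 : ∀ x y, σ (B x y) = B (σ x) (σ y))
    (X : ℕ → Module.End K N → L → L → L)
    (hD1 : ∀ w f x, D w f (σ x) = D (w + 1) (f * a) x)
    (hD3 : ∀ w f x y, D w f (B x y) = D (w + 1) (f * ℓ x) y + X w (f * a) x y)
    (ψ : Co K L N) (l : List L) :
    d1 σ a ℓ B (d2 σ a ℓ D w ψ) l + d2 σ a ℓ D (w + 1) (d1 σ a ℓ B ψ) l =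
      - qRaw σ a ℓ B D X w l (tw σ a ψ) := by
  induction l generalizing ψ with
  | nil => simp [d1_nil, d2_nil, qRaw]
  | cons x l ih =>
    have ih' := ih (ins K (σ x) ψ)
    simp only [Pi.add_apply, th_c, d1_c, d2_c, tw_c, post_c, ee_c]
    rw [qRaw, ins_tw, ← th_d2 σ a ℓ B D w h2 h4 X hD1 hD3, neg_add, neg_add,
      ← ih']
    simp only [ins_d1, ins_d2, map_sub, map_add, map_neg, Pi.sub_apply, Pi.add_apply,
      Pi.neg_apply, d1_post, d1_nil, tw_nil, hD1, pow_succ, Module.End.mul_apply, map_zero,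
      LinearMap.zero_apply, zero_mul, Pi.zero_apply]
    abel

theorem post_d2
    (h1 : ∀ x y, ℓ (σ x) * ℓ y = ℓ (B x y) * a + ℓ (σ y) * ℓ x)
    (h2 : ∀ x, a * ℓ x = ℓ (σ x) * a)
    (h4 : ∀ x y, σ (B x y) = B (σ x) (σ y))
    (X : ℕ → Module.End K N → L → L → L)
    (hD2 : ∀ w f x, σ (D w f x) = D (w + 1) (a * f) x)
    (hD4 : ∀ w f x y, B ((σ ^ w) x) (D w f y) =
      D (w + 1) (ℓ ((σ ^ w) x) * f) y + X w (a * f) x y)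
    (x : L) (ψ : Co K L N) (l : List L) :
    post L (ℓ ((σ ^ (w + 1)) x)) (d2 σ a ℓ D w ψ) l -
      d2 σ a ℓ D (w + 1) (post L (ℓ ((σ ^ w) x)) ψ) l =
      eRaw σ a ℓ B D X w x l (post L a ψ) := by
  have hB : ∀ w x y, (σ ^ w) (B x y) = B ((σ ^ w) x) ((σ ^ w) y) := by
    intro w x y
    induction w with
    | zero => simp
    | succ k ih => simp only [pow_succ', Module.End.mul_apply, ih, h4]
  have key : ∀ y, ℓ ((σ ^ (w + 1)) x) * ℓ ((σ ^ w) y) =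
      ℓ ((σ ^ w) (B x y)) * a + ℓ ((σ ^ (w + 1)) y) * ℓ ((σ ^ w) x) := by
    intro y
    rw [hB, pow_succ', Module.End.mul_apply, Module.End.mul_apply, h1]
  induction l generalizing ψ with
  | nil => simp [post_nil, d2_nil, eRaw]
  | cons y l ih =>
    simp only [Pi.add_apply, th_c, d1_c, d2_c, tw_c, post_c, ee_c]
    rw [eRaw]
    simp only [ins_post, ← ih]
    have h5 : ℓ ((σ ^ (w + 1)) x) * (ℓ (D w (ψ []) y) * a ^ w) =
        ℓ (D (w + 1) (ℓ ((σ ^ w) x) * ψ []) y) * a ^ (w + 1) +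
        (ℓ (D (w + 1) (a * ψ []) y) * a ^ w * ℓ x + ℓ (X w (a * ψ []) x y) * a ^ (w + 1)) := by
      rw [pow_succ' σ, Module.End.mul_apply, ← mul_assoc, h1, hD4, hD2, mul_assoc _ _ (ℓ x),
        pow_ell σ a ℓ w h2 x, pow_succ' a]
      simp only [map_add, add_mul, mul_assoc]
      abel
    simp only [ins_post, ins_d2, map_sub, map_add, Pi.sub_apply, Pi.add_apply, post_post,
      post_ee, post_nil, h5, key, post_add]
    abel

theorem d2_d2
    (h1 : ∀ x y, ℓ (σ x) * ℓ y = ℓ (B x y) * a + ℓ (σ y) * ℓ x)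
    (h2 : ∀ x, a * ℓ x = ℓ (σ x) * a)
    (h4 : ∀ x y, σ (B x y) = B (σ x) (σ y))
    (X : ℕ → Module.End K N → L → L → L)
    (hD2 : ∀ w f x, σ (D w f x) = D (w + 1) (a * f) x)
    (hD4 : ∀ w f x y, B ((σ ^ w) x) (D w f y) =
      D (w + 1) (ℓ ((σ ^ w) x) * f) y + X w (a * f) x y)
    (hD5 : ∀ w u y, B u ((σ ^ w) y) = D (w + 1) (ℓ u * a ^ w) y)
    (ψ : Co K L N) (l : List L) :
    d2 σ a ℓ D (w + 1) (d2 σ a ℓ D w ψ) l = qRaw σ a ℓ B D X w l (post L a ψ) := by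
  induction l generalizing ψ with
  | nil => simp [d2_nil, qRaw]
  | cons x l ih =>
    simp only [Pi.add_apply, th_c, d1_c, d2_c, tw_c, post_c, ee_c]
    rw [qRaw, ins_post, ← post_d2 σ a ℓ B D w h1 h2 h4 X hD2 hD4, ← ih]
    have h6 : d2 σ a ℓ D (w + 1) (ee L (ℓ (D w (ψ []) x) * a ^ w)) l =
        - d1 σ a ℓ B (ee L (ℓ (D (w + 1) (a * ψ []) x) * a ^ w)) l := by
      cases l with
      | nil => simp [d1_nil, d2_nil]
      | cons y l =>
        simp only [Pi.add_apply, th_c, d1_c, d2_c, tw_c, post_c, ee_c]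
        rw [ins_d1, ins_d2, ← hD2, ins_ee, ins_ee, post_ee, th_ee, map_zero,
          map_zero, ee_nil, ← hD5]
        simp only [Pi.sub_apply, Pi.add_apply, Pi.neg_apply, ← Pi.add_apply, ← map_add]
        simp only [mul_assoc, pow_ell σ a ℓ w h2 y]
        have := h1 (D w (ψ []) x) ((σ ^ w) y)
        simp only [← mul_assoc, this]
        simp only [pow_succ', Module.End.mul_apply, add_mul, mul_assoc, map_add, Pi.add_apply]
        simp
        abel
    simp only [ins_d2, map_sub, map_add, Pi.sub_apply, Pi.add_apply, h6, d2_nil, post_nil,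
      map_zero, LinearMap.zero_apply, zero_mul, Pi.zero_apply]
    abel

theorem dd
    (h1 : ∀ x y, ℓ (σ x) * ℓ y = ℓ (B x y) * a + ℓ (σ y) * ℓ x)
    (h2 : ∀ x, a * ℓ x = ℓ (σ x) * a)
    (h3 : ∀ x y z, B (σ x) (B y z) = B (B x y) (σ z) + B (σ y) (B x z))
    (h4 : ∀ x y, σ (B x y) = B (σ x) (σ y))
    (X : ℕ → Module.End K N → L → L → L)
    (hD1 : ∀ w f x, D w f (σ x) = D (w + 1) (f * a) x)
    (hD2 : ∀ w f x, σ (D w f x) = D (w + 1) (a * f) x)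
    (hD3 : ∀ w f x y, D w f (B x y) = D (w + 1) (f * ℓ x) y + X w (f * a) x y)
    (hD4 : ∀ w f x y, B ((σ ^ w) x) (D w f y) =
      D (w + 1) (ℓ ((σ ^ w) x) * f) y + X w (a * f) x y)
    (hD5 : ∀ w u y, B u ((σ ^ w) y) = D (w + 1) (ℓ u * a ^ w) y)
    (ψ : Co K L N) (hψ : ML ψ) (l : List L) (hl : tw σ a ψ = post L a ψ) :
    (d1 σ a ℓ B + d2 σ a ℓ D (w + 1)) ((d1 σ a ℓ B + d2 σ a ℓ D w) ψ) l = 0 := by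
  have e1 := congrFun (d1_d1 σ a ℓ B h1 h2 h3 h4 ψ hψ) l
  have e2 := d1_d2 σ a ℓ B D w h2 h4 X hD1 hD3 ψ l
  have e3 := d2_d2 σ a ℓ B D w h1 h2 h4 X hD2 hD4 hD5 ψ l
  rw [hl, ← e3] at e2
  simp only [LinearMap.add_apply, map_add, Pi.add_apply, e1, Pi.zero_apply]
  rw [zero_add, ← add_assoc, add_comm (d2 σ a ℓ D (w+1) _ l), e2]
  simp

end
end ListPart
end NambuAux

namespace NambuAux
section Formula
set_option linter.unusedSectionVars false
set_option linter.unusedSimpArgs false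
variable {K L N : Type*} [Field K] [AddCommGroup L] [Module K L] [AddCommGroup N] [Module K N]

theorem ML.add {f g : Co K L N} (hf : ML f) (hg : ML g) : ML (f + g) := fun l₁ l₂ =>
  ⟨fun x y => by simp only [Pi.add_apply, (hf l₁ l₂).map_add, (hg l₁ l₂).map_add]; abel,
   fun c x => by simp only [Pi.add_apply, (hf l₁ l₂).map_smul, (hg l₁ l₂).map_smul, smul_add]⟩

theorem ML.neg {f : Co K L N} (hf : ML f) : ML (-f) := fun l₁ l₂ =>
  ⟨fun x y => by simp only [Pi.neg_apply, (hf l₁ l₂).map_add]; abel,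
   fun c x => by simp only [Pi.neg_apply, (hf l₁ l₂).map_smul, smul_neg]⟩

/-- A cochain is multilinear if it is linear in its head and its insertions are multilinear at
shorter prefixes. -/
theorem isLin_add {f g : L → Module.End K N} (hf : IsLinearMap K f) (hg : IsLinearMap K g) :
    IsLinearMap K (fun x => f x + g x) :=
  ⟨fun x y => by simp only [hf.map_add, hg.map_add]; abel,
   fun c x => by simp only [hf.map_smul, hg.map_smul, smul_add]⟩

theorem isLin_neg {f : L → Module.End K N} (hf : IsLinearMap K f) :
    IsLinearMap K (fun x => - f x) :=
  ⟨fun x y => by simp only [hf.map_add]; abel,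
   fun c x => by simp only [hf.map_smul, smul_neg]⟩

variable (σ : L →ₗ[K] L) (a : Module.End K N) (ℓ : L →ₗ[K] Module.End K N)
    (B : L →ₗ[K] L →ₗ[K] L) (D : ℕ → Module.End K N →ₗ[K] L →ₗ[K] L) (w : ℕ)

theorem ML.tw {f : Co K L N} (hf : ML f) : ML (tw σ a f) := by
  intro l₁ l₂
  have h := hf (l₁.map σ) (l₂.map σ)
  constructor
  · intro x y
    simp only [NambuAux.tw, LinearMap.coe_mk, AddHom.coe_mk, List.map_append, List.map_cons,
      map_add, h.map_add, add_mul]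
  · intro x y
    simp only [NambuAux.tw, LinearMap.coe_mk, AddHom.coe_mk, List.map_append, List.map_cons,
      map_smul, h.map_smul, smul_mul_assoc]

theorem ML.post {f : Co K L N} (hf : ML f) (T : Module.End K N) : ML (post L T f) := by
  intro l₁ l₂
  have h := hf l₁ l₂
  constructor
  · intro x y
    simp only [NambuAux.post, LinearMap.coe_mk, AddHom.coe_mk, h.map_add, mul_add]
  · intro x y
    simp only [NambuAux.post, LinearMap.coe_mk, AddHom.coe_mk, h.map_smul, mul_smul_comm]

theorem ML.ee (T : Module.End K N) : ML (ee L T) := by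
  intro l₁ l₂
  cases l₁ <;> exact ⟨fun _ _ => by simp [NambuAux.ee], fun _ _ => by simp [NambuAux.ee]⟩

theorem ML.th {f : Co K L N} (hf : ML f) (x : L) : ML (th σ a ℓ B x f) := by
  intro l₁
  induction l₁ generalizing f with
  | nil =>
    intro l₂
    constructor
    · intro y z
      simp only [List.nil_append, th_c, ins_th, map_add, hf.ins_add, Pi.add_apply]; abel
    · intro c y
      simp only [List.nil_append, th_c, ins_th, map_smul, hf.ins_smul, Pi.add_apply, Pi.smul_apply,
        smul_add]
  | cons u l₁ ih =>
    intro l₂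
    simp only [List.cons_append, th_c, ins_th, Pi.add_apply]
    exact isLin_add (ih (hf.ins _) l₂) (((hf.ins _).tw σ a) l₁ l₂)

theorem th_isLin {f : Co K L N} (hf : ML f) (l : List L) :
    IsLinearMap K (fun x => NambuAux.th σ a ℓ B x f l) := by
  induction l generalizing f with
  | nil =>
    constructor
    · intro y z
      simp only [th_nil, map_add, mul_add]
    · intro y z
      simp only [th_nil, map_smul, mul_smul_comm]
  | cons u l ih =>
    simp only [th_c, ins_th, Pi.add_apply]
    refine isLin_add (ih (hf.ins _)) ?_
    constructor
    · intro y z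
      simp only [map_add, hf.ins_add, Pi.add_apply, LinearMap.add_apply]
    · intro y z
      simp only [map_smul, hf.ins_smul, Pi.smul_apply, LinearMap.smul_apply]

theorem ML.d1 {f : Co K L N} (hf : ML f) : ML (d1 σ a ℓ B f) := by
  intro l₁
  induction l₁ generalizing f with
  | nil =>
    intro l₂
    simp only [List.nil_append, d1_c, ins_d1, Pi.sub_apply, Pi.neg_apply, sub_eq_add_neg]
    refine isLin_add (isLin_neg (th_isLin σ a ℓ B hf l₂)) (isLin_neg ?_)
    constructor
    · intro y z
      simp only [map_add, hf.ins_add, Pi.add_apply]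
    · intro c y
      simp only [map_smul, hf.ins_smul, Pi.smul_apply]
  | cons u l₁ ih =>
    intro l₂
    simp only [List.cons_append, d1_c, ins_d1, Pi.sub_apply, Pi.neg_apply, sub_eq_add_neg]
    exact isLin_add (isLin_neg ((hf.th σ a ℓ B u) l₁ l₂)) (isLin_neg (ih (hf.ins _) l₂))

theorem ML.d2 {f : Co K L N} (hf : ML f) : ML (d2 σ a ℓ D w f) := by
  intro l₁
  induction l₁ generalizing f with
  | nil =>
    intro l₂
    simp only [List.nil_append, d2_c, ins_d2, Pi.sub_apply, Pi.add_apply, sub_eq_add_neg]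
    constructor
    · intro y z
      simp only [map_add, hf.ins_add, Pi.add_apply, Pi.neg_apply, post_add, add_mul]; abel
    · intro c y
      simp only [map_smul, hf.ins_smul, Pi.smul_apply, Pi.neg_apply, post_smul, smul_mul_assoc, smul_add,
        smul_neg]
  | cons u l₁ ih =>
    intro l₂
    simp only [List.cons_append, d2_c, ins_d2, Pi.sub_apply, Pi.add_apply, sub_eq_add_neg]
    exact isLin_add (isLin_add ((hf.post _) l₁ l₂) (isLin_neg (ih (hf.ins _) l₂)))
      (ML.ee _ l₁ l₂)

theorem ML.ext_gen {ι : Type*} (gen : ι → L) (hgen : Submodule.span K (Set.range gen) = ⊤)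
    {f g : Co K L N} (hf : ML f) (hg : ML g) (q : ℕ)
    (h : ∀ v : Fin q → ι, f (List.ofFn (fun j => gen (v j))) = g (List.ofFn (fun j => gen (v j))))
    (x : Fin q → L) : f (List.ofFn x) = g (List.ofFn x) := by
  induction q generalizing f g with
  | zero => simpa using h Fin.elim0
  | succ q ih =>
    rw [List.ofFn_succ]
    have key : ∀ u : L, u ∈ Submodule.span K (Set.range gen) →
        f (u :: List.ofFn fun i : Fin q => x i.succ) = g (u :: List.ofFn fun i : Fin q => x i.succ) := by
      intro u hu
      have hF := hf [] (List.ofFn fun i : Fin q => x i.succ)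
      have hG := hg [] (List.ofFn fun i : Fin q => x i.succ)
      induction hu using Submodule.span_induction with
      | mem u hu =>
        obtain ⟨i, rfl⟩ := hu
        refine ih (hf.ins (gen i)) (hg.ins (gen i)) (fun v => ?_) (fun i => x i.succ)
        have := h (Fin.cons i v)
        rw [List.ofFn_succ] at this
        simp only [Fin.cons_zero, Fin.cons_succ] at this
        exact this
      | zero => exact hF.map_zero.trans hG.map_zero.symm
      | add y z _ _ hy hz =>
        refine (hF.map_add y z).trans (Eq.trans ?_ (hG.map_add y z).symm)
        exact congrArg₂ (· + ·) hy hz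
      | smul c y _ hy =>
        refine (hF.map_smul c y).trans (Eq.trans ?_ (hG.map_smul c y).symm)
        exact congrArg (c • ·) hy
    exact key _ (hgen ▸ Submodule.mem_top)

theorem th_formula (x : L) {q : ℕ} (ψ : Co K L N) (y : Fin q → L) :
    th σ a ℓ B x ψ (List.ofFn y) =
      ∑ j, ψ (List.ofFn (Function.update (fun l => σ (y l)) j (B x (y j)))) * a
        + ψ (List.ofFn (fun l => σ (y l))) * ℓ x := by
  induction q generalizing ψ with
  | zero => simp [th_nil]
  | succ q ih =>
    rw [List.ofFn_succ, th_c, ins_th, Pi.add_apply, ih, Fin.sum_univ_succ]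
    have e1 : tw σ a (ins K (B x (y 0)) ψ) (List.ofFn fun i => y i.succ) =
        ψ (List.ofFn (Function.update (fun l => σ (y l)) 0 (B x (y 0)))) * a := by
      rw [List.ofFn_succ]
      simp [tw, ins, List.map_ofFn, Function.comp_def, Function.update_of_ne (Fin.succ_ne_zero _)]
    have e2 : ∀ j : Fin q,
        ψ (List.ofFn (Function.update (fun l => σ (y l)) j.succ (B x (y j.succ)))) =
        ins K (σ (y 0)) ψ (List.ofFn (Function.update (fun l => σ (y l.succ)) j (B x (y j.succ)))) := by
      intro j
      rw [List.ofFn_succ]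
      have : (fun i => Function.update (fun l => σ (y l)) j.succ (B x (y j.succ)) (Fin.succ i)) =
         Function.update (fun l => σ (y l.succ)) j (B x (y j.succ)) := by
        funext i
        by_cases h : i = j
        · subst h; simp
        · simp [Function.update_of_ne, h]
      rw [this, Function.update_of_ne (Fin.succ_ne_zero j).symm]
      rfl
    rw [e1]
    simp only [e2]
    rw [List.ofFn_succ (f := fun l => σ (y l))]
    simp only [ins, LinearMap.coe_mk, AddHom.coe_mk]
    abel

theorem ofFn_succAbove {α : Type*} {q : ℕ} (c : Fin (q + 2) → α) (i : Fin (q + 1)) :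
    List.ofFn (c ∘ i.succ.succAbove) = c 0 :: List.ofFn ((fun k => c k.succ) ∘ i.succAbove) := by
  rw [List.ofFn_succ]
  simp [Function.comp_def, Fin.succ_succAbove_zero, Fin.succ_succAbove_succ]

theorem update_succ {α : Type*} {q : ℕ} (c : Fin (q + 1) → α) (j : Fin q) (b : α) :
    (fun k => Function.update c j.succ b (Fin.succ k)) =
      Function.update (fun k => c (Fin.succ k)) j b := by
  funext i
  by_cases h : i = j
  · subst h; simp
  · simp [Function.update_of_ne, h]

theorem neg_ite {p : Prop} [Decidable p] (x : Module.End K N) :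
    (if p then -x else 0) = -(if p then x else 0) := by split <;> simp

theorem d1_formula {q : ℕ} (ψ : Co K L N) (c : Fin (q + 1) → L) :
    d1 σ a ℓ B ψ (List.ofFn c) =
      (∑ i : Fin (q + 1), ∑ j : Fin (q + 1), if i < j then ((-1 : ℤ) ^ ((i : ℕ) + 1)) •
        (ψ (List.ofFn ((Function.update (fun l => σ (c l)) j (B (c i) (c j))) ∘ i.succAbove)) * a)
        else 0) +
      ∑ i : Fin (q + 1), ((-1 : ℤ) ^ ((i : ℕ) + 1)) •
        (ψ (List.ofFn ((fun l => σ (c l)) ∘ i.succAbove)) * ℓ (c i)) := by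
  induction q generalizing ψ with
  | zero =>
    rw [List.ofFn_succ, d1_c, ins_d1]
    simp [th_nil, d1_nil]
  | succ q ih =>
    rw [List.ofFn_succ, d1_c, ins_d1, Pi.sub_apply, ih, Pi.neg_apply, th_formula]
    rw [Fin.sum_univ_succ (n := q + 1), Fin.sum_univ_succ (n := q + 1)
      (f := fun i => ((-1 : ℤ) ^ ((i : ℕ) + 1)) • (_ * _))]
    simp only [Fin.sum_univ_succ (n := q + 1) (f := fun j => ite _ _ _)]
    simp only [ofFn_succAbove]
    simp only [lt_self_iff_false, if_false, Fin.succ_pos, if_true, zero_add,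
      Fin.not_lt_zero, Fin.succ_lt_succ_iff, Fin.succAbove_zero, Fin.val_succ, Fin.val_zero,
      update_succ, Function.comp_def, Function.update_of_ne (Fin.succ_ne_zero _).symm]
    simp only [ins, LinearMap.coe_mk, AddHom.coe_mk, pow_succ _ (_ + 1), mul_neg, mul_one, neg_smul,
      Finset.sum_neg_distrib, pow_zero, pow_one, one_smul, zero_add, neg_ite]
    abel

theorem d2_formula {q : ℕ} (ψ : Co K L N) (c : Fin (q + 1) → L) :
    d2 σ a ℓ D w ψ (List.ofFn c) =
      ∑ i : Fin (q + 1), ((-1 : ℤ) ^ (i : ℕ)) •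
        (ℓ ((σ ^ w) (c i)) * ψ (List.ofFn (c ∘ i.succAbove))) +
      ((-1 : ℤ) ^ q) • (ℓ (D w (ψ (List.ofFn (fun j : Fin q => c j.castSucc))) (c (Fin.last q)))
        * a ^ w) := by
  induction q generalizing ψ with
  | zero =>
    rw [List.ofFn_succ, d2_c, ins_d2]
    simp [post_nil, d2_nil, ee_nil]
  | succ q ih =>
    rw [List.ofFn_succ, d2_c, ins_d2, Pi.add_apply, Pi.sub_apply, ih]
    rw [Fin.sum_univ_succ (n := q + 1)]
    simp only [ofFn_succAbove]
    rw [List.ofFn_succ (f := fun j : Fin (q+1) => c j.castSucc), List.ofFn_succ, ee_c, ins_ee]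
    simp only [ins, post, LinearMap.coe_mk, AddHom.coe_mk, pow_succ, mul_neg, mul_one, neg_smul,
      Finset.sum_neg_distrib, Fin.val_succ, Fin.val_zero, pow_zero, one_smul, Fin.succAbove_zero,
      Fin.succ_last, Fin.castSucc_zero, Fin.succ_castSucc, Function.comp_def, List.ofFn_succ,
      Pi.zero_apply]
    abel
end Formula
end NambuAux

namespace NambuAux
section Ext
set_option linter.unusedSectionVars false
set_option linter.unusedSimpArgs false
variable {K : Type*} [Field K] {n : ℕ}

theorem wedgeGen_eq {N : Type*} [AddCommGroup N] [Module K N] (v : Fin n → N) :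
    wedgeGen K n v = exteriorPower.ιMulti K n v := rfl

theorem span_wedgeGen (N : Type*) [AddCommGroup N] [Module K N] :
    Submodule.span K (Set.range (wedgeGen K (N := N) n)) = ⊤ :=
  exteriorPower.ιMulti_span K n N

theorem gen_induction {N : Type*} [AddCommGroup N] [Module K N] {P : ⋀[K]^n N → Prop}
    (hg : ∀ v, P (wedgeGen K n v)) (ha : ∀ x y, P x → P y → P (x + y))
    (hs : ∀ (c : K) x, P x → P (c • x)) (x : ⋀[K]^n N) : P x := by
  have hx : x ∈ Submodule.span K (Set.range (wedgeGen K (N := N) n)) := by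
    rw [span_wedgeGen]; trivial
  induction hx using Submodule.span_induction with
  | mem u hu => obtain ⟨v, rfl⟩ := hu; exact hg v
  | zero => simpa using hs 0 _ (hg 0)
  | add y z _ _ hy hz => exact ha _ _ hy hz
  | smul c y _ hy => exact hs _ _ hy

variable {N N' NP NQ : Type*} [AddCommGroup N] [Module K N] [AddCommGroup N'] [Module K N']
  [AddCommGroup NP] [Module K NP] [AddCommGroup NQ] [Module K NQ]

theorem ite_eq_update (c f : N →ₗ[K] N') (v : Fin n → N) (i : Fin n) :
    (fun k => (if k = i then f else c) (v k)) = Function.update (fun k => c (v k)) i (f (v i)) := by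
  funext k
  by_cases h : k = i
  · subst h; simp
  · simp [h]

/-- The derivation `v ↦ Σ_i c v₁ ∧ ... ∧ f vᵢ ∧ ... ∧ c vₙ` as an alternating map. -/
noncomputable def dAlt (n : ℕ) (c f : N →ₗ[K] N') : AlternatingMap K N (⋀[K]^n N') (Fin n) where
  toMultilinearMap := ∑ i : Fin n, (exteriorPower.ιMulti K n (M := N')).toMultilinearMap.compLinearMap
    (fun k => if k = i then f else c)
  map_eq_zero_of_eq' := by
    intro v i j hij hne
    simp only [MultilinearMap.toFun_eq_coe, _root_.sum_apply,
      MultilinearMap.compLinearMap_apply, ite_eq_update, AlternatingMap.coe_multilinearMap]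
    rw [Finset.sum_eq_add_of_mem i j (Finset.mem_univ _) (Finset.mem_univ _) hne]
    · have : Function.update (fun k => c (v k)) j (f (v j)) =
        (Function.update (fun k => c (v k)) i (f (v i))) ∘ Equiv.swap i j := by
        funext k
        by_cases h1 : k = i
        · subst h1
          simp [Function.update_of_ne hne, Function.update_of_ne hne.symm, hij]
        · by_cases h2 : k = j
          · subst h2; simp [hij]
          · simp [Equiv.swap_apply_of_ne_of_ne h1 h2, h1, h2]
      rw [this, AlternatingMap.map_swap _ _ hne]
      simp
    · intro k _ hk
      refine AlternatingMap.map_eq_zero_of_eq _ _ ?_ hne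
      rw [Function.update_of_ne hk.1.symm, Function.update_of_ne hk.2.symm, hij]

theorem dAlt_apply (c f : N →ₗ[K] N') (v : Fin n → N) :
    dAlt n c f v = ∑ i, wedgeGen K n (Function.update (fun k => c (v k)) i (f (v i))) := by
  change (∑ i : Fin n, (exteriorPower.ιMulti K n (M := N')).toMultilinearMap.compLinearMap
    (fun k => if k = i then f else c)) v = _
  simp only [_root_.sum_apply,
      MultilinearMap.compLinearMap_apply, ite_eq_update, AlternatingMap.coe_multilinearMap,
      wedgeGen_eq]

noncomputable def dEx (n : ℕ) (c f : N →ₗ[K] N') : ⋀[K]^n N →ₗ[K] ⋀[K]^n N' :=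
  exteriorPower.alternatingMapLinearEquiv (dAlt n c f)

theorem dEx_gen (c f : N →ₗ[K] N') (v : Fin n → N) :
    dEx n c f (wedgeGen K n v) =
      ∑ i, wedgeGen K n (Function.update (fun k => c (v k)) i (f (v i))) := by
  rw [dEx, wedgeGen_eq, exteriorPower.alternatingMapLinearEquiv_apply_ιMulti, dAlt_apply]

theorem dEx_add (c f g : N →ₗ[K] N') : dEx n c (f + g) = dEx n c f + dEx n c g := by
  ext1
  ext v : 1
  change dEx n c (f + g) (wedgeGen K n v) =
    dEx n c f (wedgeGen K n v) + dEx n c g (wedgeGen K n v)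
  simp only [dEx_gen, LinearMap.add_apply]
  simp only [wedgeGen_eq, AlternatingMap.map_update_add, Finset.sum_add_distrib]

theorem dEx_smul (c : N →ₗ[K] N') (r : K) (f : N →ₗ[K] N') : dEx n c (r • f) = r • dEx n c f := by
  ext1
  ext v : 1
  change dEx n c (r • f) (wedgeGen K n v) = r • dEx n c f (wedgeGen K n v)
  simp only [dEx_gen, LinearMap.smul_apply]
  simp only [wedgeGen_eq, AlternatingMap.map_update_smul, Finset.smul_sum]

noncomputable def dL (n : ℕ) (c : N →ₗ[K] N') : (N →ₗ[K] N') →ₗ[K] ⋀[K]^n N →ₗ[K] ⋀[K]^n N' where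
  toFun f := dEx n c f
  map_add' := dEx_add c
  map_smul' := dEx_smul c

noncomputable def mixv (c g h : N →ₗ[K] N') (v : Fin n → N) : ⋀[K]^n N' :=
  ∑ i, ∑ j, if j = i then 0 else
    wedgeGen K n (Function.update (Function.update (fun k => c (v k)) i (g (v i))) j (h (v j)))

theorem mixv_symm (c g h : N →ₗ[K] N') (v : Fin n → N) : mixv c g h v = mixv c h g v := by
  unfold mixv
  rw [Finset.sum_comm]
  refine Finset.sum_congr rfl fun i _ => Finset.sum_congr rfl fun j _ => ?_
  by_cases hij : i = j
  · simp [hij]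
  · rw [if_neg hij, if_neg (Ne.symm hij), Function.update_comm hij]

theorem dL_dL_gen (c f : N →ₗ[K] N') (c' f' : N' →ₗ[K] NP) (v : Fin n → N) :
    dL n c' f' (dL n c f (wedgeGen K n v)) = dL n (c' ∘ₗ c) (f' ∘ₗ f) (wedgeGen K n v) +
      mixv (c' ∘ₗ c) (c' ∘ₗ f) (f' ∘ₗ c) v := by
  change dEx n c' f' (dEx n c f (wedgeGen K n v)) = dEx n (c' ∘ₗ c) (f' ∘ₗ f) (wedgeGen K n v) + _
  simp only [dEx_gen, map_sum, mixv]
  rw [← Finset.sum_add_distrib]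
  refine Finset.sum_congr rfl fun i _ => ?_
  have e : ∀ u, (fun k => c' (Function.update (fun k => c (v k)) i u k)) =
      Function.update (fun k => c' (c (v k))) i (c' u) := by
    intro u
    funext k
    by_cases h : k = i
    · subst h; simp
    · simp [h]
  simp only [e]
  rw [← Finset.add_sum_erase _ _ (Finset.mem_univ i),
    ← Finset.add_sum_erase (a := i) (f := fun j => ite (j = i) _ _) _ (Finset.mem_univ i)]
  simp only [if_true, zero_add, Function.update_self, Function.update_idem, LinearMap.comp_apply]
  congr 1
  refine Finset.sum_congr rfl fun j hj => ?_
  have hj' := Finset.ne_of_mem_erase hj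
  rw [if_neg hj', Function.update_of_ne hj']

noncomputable def mixL (c g h : N →ₗ[K] N') : ⋀[K]^n N →ₗ[K] ⋀[K]^n N' :=
  dL n (LinearMap.coprod c g) (LinearMap.coprod h 0) ∘ₗ
    dL n (LinearMap.inl K N N) (LinearMap.inr K N N)

theorem mixL_gen (c g h : N →ₗ[K] N') (v : Fin n → N) :
    mixL c g h (wedgeGen K n v) = mixv c g h v := by
  rw [mixL, LinearMap.comp_apply, dL_dL_gen]
  simp

theorem mixL_symm (c g h : N →ₗ[K] N') (x : ⋀[K]^n N) : mixL c g h x = mixL c h g x := by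
  induction x using gen_induction with
  | hg v => rw [mixL_gen, mixL_gen, mixv_symm]
  | ha x y hx hy => rw [map_add, map_add, hx, hy]
  | hs r x hx => rw [map_smul, map_smul, hx]

theorem dL_dL (c f : N →ₗ[K] N') (c' f' : N' →ₗ[K] NP) (x : ⋀[K]^n N) :
    dL n c' f' (dL n c f x) = dL n (c' ∘ₗ c) (f' ∘ₗ f) x +
      mixL (c' ∘ₗ c) (c' ∘ₗ f) (f' ∘ₗ c) x := by
  induction x using gen_induction with
  | hg v => rw [mixL_gen, dL_dL_gen]
  | ha x y hx hy => simp only [map_add, hx, hy]; abel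
  | hs r x hx => simp only [map_smul, hx, smul_add]

theorem dL_map (s : ⋀[K]^n N →ₗ[K] ⋀[K]^n N') (c : N →ₗ[K] N')
    (hs : ∀ v : Fin n → N, s (wedgeGen K n v) = wedgeGen K n (fun i => c (v i)))
    (c' f' : N' →ₗ[K] NP) (x : ⋀[K]^n N) :
    dL n c' f' (s x) = dL n (c' ∘ₗ c) (f' ∘ₗ c) x := by
  induction x using gen_induction with
  | hg v =>
    rw [hs]
    change dEx n _ _ _ = dEx n _ _ _
    simp only [dEx_gen, LinearMap.comp_apply]
  | ha x y hx hy => simp only [map_add, hx, hy]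
  | hs r x hx => simp only [map_smul, hx, smul_add]

theorem map_dL (s : ⋀[K]^n N' →ₗ[K] ⋀[K]^n NP) (c : N' →ₗ[K] NP)
    (hs : ∀ v : Fin n → N', s (wedgeGen K n v) = wedgeGen K n (fun i => c (v i)))
    (c' f' : N →ₗ[K] N') (x : ⋀[K]^n N) :
    s (dL n c' f' x) = dL n (c ∘ₗ c') (c ∘ₗ f') x := by
  induction x using gen_induction with
  | hg v =>
    change s (dEx n _ _ _) = dEx n _ _ _
    simp only [dEx_gen, LinearMap.comp_apply, map_sum, hs]
    refine Finset.sum_congr rfl fun i _ => congrArg _ ?_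
    funext k
    by_cases h : k = i
    · subst h; simp
    · simp [h]
  | ha x y hx hy => simp only [map_add, hx, hy]
  | hs r x hx => simp only [map_smul, hx, smul_add]

end Ext
end NambuAux

namespace NambuAux
section Fin
variable {K N : Type*} [Field K] [AddCommGroup N] [Module K N] {n : ℕ}

/-- Extension of a multilinear map to all lists. -/
noncomputable def hat {L : Type*} [AddCommGroup L] [Module K L] {p : ℕ}
    (φ : MultilinearMap K (fun _ : Fin p => L) (N →ₗ[K] N)) : Co K L N :=
  fun l => if h : l.length = p then φ (fun i => l.get (Fin.cast h.symm i)) else 0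

theorem hat_ofFn {L : Type*} [AddCommGroup L] [Module K L] {p : ℕ}
    (φ : MultilinearMap K (fun _ : Fin p => L) (N →ₗ[K] N)) (x : Fin p → L) :
    hat φ (List.ofFn x) = φ x := by
  rw [hat, dif_pos (List.length_ofFn)]
  congr 1
  funext i
  simp

theorem hat_ML {L : Type*} [AddCommGroup L] [Module K L] {p : ℕ}
    (φ : MultilinearMap K (fun _ : Fin p => L) (N →ₗ[K] N)) : ML (hat φ) := by
  intro l₁ l₂
  by_cases h : (l₁ ++ (0 : L) :: l₂).length = p
  · have hlt : l₁.length < p := by simp at h; omega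
    have hx : ∀ x, hat φ (l₁ ++ x :: l₂) = φ (Function.update
        (fun i => (l₁ ++ (0 : L) :: l₂).get (Fin.cast h.symm i)) ⟨l₁.length, hlt⟩ x) := by
      intro x
      have h' : (l₁ ++ x :: l₂).length = p := by simpa using h
      rw [hat, dif_pos h']
      congr 1
      funext i
      by_cases hi : i = ⟨l₁.length, hlt⟩
      · subst hi; simp
      · rw [Function.update_of_ne hi]
        have hi' : (i : ℕ) ≠ l₁.length := fun e => hi (Fin.ext e)
        simp only [List.get_eq_getElem, Fin.val_cast, List.getElem_append]
        split_ifs with hlt'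
        · rfl
        · obtain ⟨k, hk⟩ : ∃ k, (i : ℕ) - l₁.length = k + 1 :=
            ⟨(i : ℕ) - l₁.length - 1, by omega⟩
          simp only [hk, List.getElem_cons_succ]
    constructor
    · intro x y; simp only [hx, MultilinearMap.map_update_add]
    · intro c x; simp only [hx, MultilinearMap.map_update_smul]
  · have hx : ∀ x, hat φ (l₁ ++ x :: l₂) = 0 := by
      intro x
      rw [hat, dif_neg (by simpa using h)]
    constructor
    · intro x y; simp only [hx, add_zero]
    · intro c x; simp only [hx, smul_zero]

theorem hat_tw {L : Type*} [AddCommGroup L] [Module K L] {p : ℕ}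
    (φ : MultilinearMap K (fun _ : Fin p => L) (N →ₗ[K] N)) (σ : L →ₗ[K] L) (α : N →ₗ[K] N)
    (hφα : ∀ (x : Fin p → L) (z : N), α (φ x z) = φ (fun j => σ (x j)) (α z)) :
    tw σ α (hat φ) = post L α (hat φ) := by
  funext l
  change hat φ (l.map σ) * α = α * hat φ l
  by_cases h : l.length = p
  · rw [hat, hat, dif_pos h, dif_pos (by simpa using h)]
    ext z
    simp only [Module.End.mul_apply, hφα, List.get_eq_getElem, Fin.val_cast, List.getElem_map]
  · rw [hat, hat, dif_neg h, dif_neg (by simpa using h)]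
    simp

theorem delta_eq (br : AlternatingMap K N N (Fin (n + 1))) (α : N →ₗ[K] N)
    (Lop : ⋀[K]^n N →ₗ[K] N →ₗ[K] N)
    (hLop : ∀ (v : Fin n → N) (z : N), Lop (wedgeGen K n v) z = br (Fin.snoc v z))
    (αt : ⋀[K]^n N →ₗ[K] ⋀[K]^n N)
    (B : ⋀[K]^n N →ₗ[K] ⋀[K]^n N →ₗ[K] ⋀[K]^n N)
    (q : ℕ) (ψ : Co K (⋀[K]^n N) N) (v : Fin (q + 1) → Fin n → N) (z : N) :
    nambuDeltaOnGen br α Lop αt B (fun x z => ψ (List.ofFn x) z) v z =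
      (d1 αt α Lop B + d2 αt α Lop (fun w => dL n (α ^ w)) q) ψ
        (List.ofFn fun j => wedgeGen K n (v j)) z := by
  rw [LinearMap.add_apply, Pi.add_apply, d1_formula, d2_formula]
  have e : ∀ f : N →ₗ[K] N, dL n (α ^ q) f (wedgeGen K n (v (Fin.last q))) =
    ∑ i, wedgeGen K n (Function.update (fun k => (α ^ q) (v (Fin.last q) k)) i
      (f (v (Fin.last q) i))) := fun f => dEx_gen _ _ _
  simp only [e, map_sum, nambuDeltaOnGen, LinearMap.add_apply, LinearMap.sum_apply,
    LinearMap.smul_apply, Module.End.mul_apply, hLop, apply_ite (fun f : N →ₗ[K] N => f z),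
    LinearMap.zero_apply]
  simp only [add_assoc]

end Fin
end NambuAux

namespace NambuAux
section Ids
variable {K N : Type*} [Field K] [AddCommGroup N] [Module K N] {n : ℕ}

theorem comp_snoc (α : N →ₗ[K] N) (v : Fin n → N) (z : N) :
    (fun i => α ((Fin.snoc v z : Fin (n + 1) → N) i)) =
      (Fin.snoc (fun i => α (v i)) (α z) : Fin (n + 1) → N) := by
  funext i
  refine Fin.lastCases ?_ (fun j => ?_) i <;> simp

theorem id_h1 (br : AlternatingMap K N N (Fin (n + 1))) (α : N →ₗ[K] N)
    (hNambu : ∀ (x : Fin n → N) (y : Fin (n + 1) → N),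
      br (Fin.snoc (fun j => α (x j)) (br y)) =
        ∑ i : Fin (n + 1),
          br (Function.update (fun j => α (y j)) i (br (Fin.snoc x (y i)))))
    (Lop : ⋀[K]^n N →ₗ[K] N →ₗ[K] N)
    (hLop : ∀ (v : Fin n → N) (z : N), Lop (wedgeGen K n v) z = br (Fin.snoc v z))
    (αt : ⋀[K]^n N →ₗ[K] ⋀[K]^n N)
    (hαt : ∀ v : Fin n → N, αt (wedgeGen K n v) = wedgeGen K n (fun i => α (v i)))
    (B : ⋀[K]^n N →ₗ[K] ⋀[K]^n N →ₗ[K] ⋀[K]^n N)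
    (hB : ∀ v w : Fin n → N,
      B (wedgeGen K n v) (wedgeGen K n w) =
        ∑ i : Fin n,
          wedgeGen K n (Function.update (fun j => α (w j)) i (br (Fin.snoc v (w i)))))
    (x y : ⋀[K]^n N) (z : N) :
    Lop (αt x) (Lop y z) = Lop (B x y) (α z) + Lop (αt y) (Lop x z) := by
  induction x using gen_induction with
  | hg v =>
    induction y using gen_induction with
    | hg w =>
      rw [hαt, hαt, hB]
      simp only [hLop, map_sum, LinearMap.sum_apply]
      rw [hNambu, Fin.sum_univ_castSucc]
      simp only [comp_snoc, Fin.snoc_castSucc, Fin.snoc_last, Fin.update_snoc_last,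
        Fin.snoc_update]
    | ha x y hx hy => simp only [map_add, LinearMap.add_apply, hx, hy]; abel
    | hs r x hx => simp only [map_smul, LinearMap.smul_apply, hx, smul_add]
  | ha x y hx hy => simp only [map_add, LinearMap.add_apply, hx, hy]; abel
  | hs r x hx => simp only [map_smul, LinearMap.smul_apply, hx, smul_add]

theorem id_h2 (br : AlternatingMap K N N (Fin (n + 1))) (α : N →ₗ[K] N)
    (hmult : ∀ v : Fin (n + 1) → N, α (br v) = br (fun i => α (v i)))
    (Lop : ⋀[K]^n N →ₗ[K] N →ₗ[K] N)
    (hLop : ∀ (v : Fin n → N) (z : N), Lop (wedgeGen K n v) z = br (Fin.snoc v z))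
    (αt : ⋀[K]^n N →ₗ[K] ⋀[K]^n N)
    (hαt : ∀ v : Fin n → N, αt (wedgeGen K n v) = wedgeGen K n (fun i => α (v i)))
    (x : ⋀[K]^n N) (z : N) : α (Lop x z) = Lop (αt x) (α z) := by
  induction x using gen_induction with
  | hg v => rw [hαt, hLop, hLop, hmult, comp_snoc]
  | ha x y hx hy => simp only [map_add, LinearMap.add_apply, hx, hy]
  | hs r x hx => simp only [map_smul, LinearMap.smul_apply, hx]

theorem id_BD (br : AlternatingMap K N N (Fin (n + 1))) (α : N →ₗ[K] N)
    (Lop : ⋀[K]^n N →ₗ[K] N →ₗ[K] N)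
    (hLop : ∀ (v : Fin n → N) (z : N), Lop (wedgeGen K n v) z = br (Fin.snoc v z))
    (B : ⋀[K]^n N →ₗ[K] ⋀[K]^n N →ₗ[K] ⋀[K]^n N)
    (hB : ∀ v w : Fin n → N,
      B (wedgeGen K n v) (wedgeGen K n w) =
        ∑ i : Fin n,
          wedgeGen K n (Function.update (fun j => α (w j)) i (br (Fin.snoc v (w i)))))
    (x y : ⋀[K]^n N) : B x y = dL n α (Lop x) y := by
  induction x using gen_induction with
  | hg v =>
    induction y using gen_induction with
    | hg w =>
      rw [hB]
      change _ = dEx n _ _ _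
      simp only [dEx_gen, hLop]
    | ha x y hx hy => simp only [map_add, hx, hy]
    | hs r x hx => simp only [map_smul, hx]
  | ha x y hx hy => simp only [map_add, LinearMap.add_apply, hx, hy]
  | hs r x hx => simp only [map_smul, LinearMap.smul_apply, hx]

theorem id_pow (α : N →ₗ[K] N) (αt : ⋀[K]^n N →ₗ[K] ⋀[K]^n N)
    (hαt : ∀ v : Fin n → N, αt (wedgeGen K n v) = wedgeGen K n (fun i => α (v i))) (w : ℕ)
    (v : Fin n → N) : (αt ^ w) (wedgeGen K n v) = wedgeGen K n (fun i => (α ^ w) (v i)) := by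
  induction w generalizing v with
  | zero => simp
  | succ w ih => simp only [pow_succ, Module.End.mul_apply, hαt, ih]

theorem dd_nambu (br : AlternatingMap K N N (Fin (n + 1))) (α : N →ₗ[K] N)
    (hmult : ∀ v : Fin (n + 1) → N, α (br v) = br (fun i => α (v i)))
    (hNambu : ∀ (x : Fin n → N) (y : Fin (n + 1) → N),
      br (Fin.snoc (fun j => α (x j)) (br y)) =
        ∑ i : Fin (n + 1),
          br (Function.update (fun j => α (y j)) i (br (Fin.snoc x (y i)))))
    (Lop : ⋀[K]^n N →ₗ[K] N →ₗ[K] N)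
    (hLop : ∀ (v : Fin n → N) (z : N), Lop (wedgeGen K n v) z = br (Fin.snoc v z))
    (αt : ⋀[K]^n N →ₗ[K] ⋀[K]^n N)
    (hαt : ∀ v : Fin n → N, αt (wedgeGen K n v) = wedgeGen K n (fun i => α (v i)))
    (B : ⋀[K]^n N →ₗ[K] ⋀[K]^n N →ₗ[K] ⋀[K]^n N)
    (hB : ∀ v w : Fin n → N,
      B (wedgeGen K n v) (wedgeGen K n w) =
        ∑ i : Fin n,
          wedgeGen K n (Function.update (fun j => α (w j)) i (br (Fin.snoc v (w i)))))
    (q : ℕ) (ψ : Co K (⋀[K]^n N) N) (hψ : ML ψ) (l : List (⋀[K]^n N))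
    (hl : tw αt α ψ = post (⋀[K]^n N) α ψ) :
    (d1 αt α Lop B + d2 αt α Lop (fun w => dL n (α ^ w)) (q + 1))
      ((d1 αt α Lop B + d2 αt α Lop (fun w => dL n (α ^ w)) q) ψ) l = 0 := by
  have h1 : ∀ x y, Lop (αt x) ∘ₗ Lop y = Lop (B x y) ∘ₗ α + Lop (αt y) ∘ₗ Lop x := fun x y =>
    LinearMap.ext fun z => id_h1 br α hNambu Lop hLop αt hαt B hB x y z
  have h2 : ∀ x, α ∘ₗ Lop x = Lop (αt x) ∘ₗ α := fun x =>
    LinearMap.ext fun z => id_h2 br α hmult Lop hLop αt hαt x z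
  have hBD := id_BD br α Lop hLop B hB
  have hpw := id_pow α αt hαt
  have pe : ∀ w x, (α ^ w) ∘ₗ Lop x = Lop ((αt ^ w) x) ∘ₗ (α ^ w) := fun w x =>
    pow_ell αt α Lop w h2 x
  have ps : ∀ w, (α ^ w) ∘ₗ α = α ^ (w + 1) := fun w => (pow_succ α w).symm
  have ps' : ∀ w, α ∘ₗ (α ^ w) = α ^ (w + 1) := fun w => (pow_succ' α w).symm
  refine dd αt α Lop B (fun w => dL n (α ^ w)) q h1 h2 ?_ ?_
    (fun w g x y => mixL (α ^ (w + 1)) ((α ^ w) ∘ₗ Lop x) g y) ?_ ?_ ?_ ?_ ?_ ψ hψ l hl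
  · intro x y z
    simp only [hBD _ z, hBD _ (αt z), hBD _ (dL _ _ _ _)]
    rw [dL_dL, dL_dL, dL_map αt α hαt, h1, map_add, LinearMap.add_apply, mixL_symm, h2, h2,
      add_assoc]
  · intro x y
    simp only [hBD _ y, hBD _ (αt y)]
    rw [dL_map αt α hαt, map_dL αt α hαt, h2]
  · intros
    rename_i w f x
    rw [dL_map αt α hαt, ps]; rfl
  · intros
    rename_i w f x
    rw [map_dL αt α hαt, ps']; rfl
  · intros
    rename_i w f x y
    rw [hBD, dL_dL, ps]; rfl
  · intros
    rename_i w f x y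
    rw [hBD, dL_dL, ps', mixL_symm, ← pe]
    rfl
  · intros
    rename_i w u y
    rw [hBD, dL_map (αt ^ w) (α ^ w) (hpw w), ps']; rfl

end Ids
end NambuAux

/-- Let `(N, br, α)` be an `(n+1)`-ary multiplicative Hom-Nambu-Lie algebra
and let `φ ∈ C^p(N, N)` be a `p`-cochain with values in `N`: a multilinear map
`L(N)^{⊗p} ⊗ N → N` (with `L(N) = ⋀^n N`) satisfying `α ∘ φ = φ ∘ (α̃,...,α̃,α)`.
If `ψ₁ = δ^p φ` and `ψ₂ = δ^{p+1} ψ₁` (multilinear maps determined by the coboundary formula on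
generators), then `ψ₂ = δ^{p+1}(δ^p(φ)) = 0`. -/
theorem nambu_coboundary_squared_zero
    {K N : Type*} [Field K] [CharZero K] [AddCommGroup N] [Module K N] (n : ℕ)
    (br : AlternatingMap K N N (Fin (n + 1))) (α : N →ₗ[K] N)
    (hmult : ∀ v : Fin (n + 1) → N, α (br v) = br (fun i => α (v i)))
    (hNambu : ∀ (x : Fin n → N) (y : Fin (n + 1) → N),
      br (Fin.snoc (fun j => α (x j)) (br y)) =
        ∑ i : Fin (n + 1),
          br (Function.update (fun j => α (y j)) i (br (Fin.snoc x (y i)))))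
    (Lop : ⋀[K]^n N →ₗ[K] N →ₗ[K] N)
    (hLop : ∀ (v : Fin n → N) (z : N), Lop (wedgeGen K n v) z = br (Fin.snoc v z))
    (αt : ⋀[K]^n N →ₗ[K] ⋀[K]^n N)
    (hαt : ∀ v : Fin n → N, αt (wedgeGen K n v) = wedgeGen K n (fun i => α (v i)))
    (B : ⋀[K]^n N →ₗ[K] ⋀[K]^n N →ₗ[K] ⋀[K]^n N)
    (hB : ∀ v w : Fin n → N,
      B (wedgeGen K n v) (wedgeGen K n w) =
        ∑ i : Fin n,
          wedgeGen K n (Function.update (fun j => α (w j)) i (br (Fin.snoc v (w i)))))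
    (p : ℕ) (φ : MultilinearMap K (fun _ : Fin p => ⋀[K]^n N) (N →ₗ[K] N))
    (hφα : ∀ (x : Fin p → ⋀[K]^n N) (z : N),
      α (φ x z) = φ (fun j => αt (x j)) (α z))
    (ψ₁ : MultilinearMap K (fun _ : Fin (p + 1) => ⋀[K]^n N) (N →ₗ[K] N))
    (hψ₁ : ∀ (v : Fin (p + 1) → Fin n → N) (z : N),
      ψ₁ (fun j => wedgeGen K n (v j)) z =
        nambuDeltaOnGen br α Lop αt B (fun a w => φ a w) v z)
    (ψ₂ : MultilinearMap K (fun _ : Fin (p + 2) => ⋀[K]^n N) (N →ₗ[K] N))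
    (hψ₂ : ∀ (v : Fin (p + 2) → Fin n → N) (z : N),
      ψ₂ (fun j => wedgeGen K n (v j)) z =
        nambuDeltaOnGen br α Lop αt B (fun a w => ψ₁ a w) v z) :
    ∀ (x : Fin (p + 2) → ⋀[K]^n N) (z : N), ψ₂ x z = 0 := by
  intro x z
  classical
  let dlt : ℕ → NambuAux.Co K (⋀[K]^n N) N →ₗ[K] NambuAux.Co K (⋀[K]^n N) N := fun q =>
    NambuAux.d1 αt α Lop B + NambuAux.d2 αt α Lop (fun w => NambuAux.dL n (α ^ w)) q
  have hML0 := NambuAux.hat_ML φ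
  have hML1 : NambuAux.ML (dlt p (NambuAux.hat φ)) :=
    (hML0.d1 αt α Lop B).add (hML0.d2 αt α Lop (fun w => NambuAux.dL n (α ^ w)) p)
  have hspan := NambuAux.span_wedgeGen (K := K) (n := n) N
  have e1 : ∀ x, ψ₁ x = dlt p (NambuAux.hat φ) (List.ofFn x) := by
    intro x
    rw [← NambuAux.hat_ofFn ψ₁ x]
    refine NambuAux.ML.ext_gen (wedgeGen K n) hspan (NambuAux.hat_ML ψ₁) hML1 (p + 1) ?_ x
    intro v
    rw [NambuAux.hat_ofFn]
    ext z
    rw [hψ₁, ← NambuAux.delta_eq br α Lop hLop αt B p (NambuAux.hat φ) v z]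
    simp only [NambuAux.hat_ofFn]
  have e2 : ∀ x : Fin (p + 2) → ⋀[K]^n N, NambuAux.hat ψ₂ (List.ofFn x) =
      (0 : NambuAux.Co K (⋀[K]^n N) N) (List.ofFn x) := by
    refine NambuAux.ML.ext_gen (wedgeGen K n) hspan (NambuAux.hat_ML ψ₂)
      (fun _ _ => ⟨fun _ _ => by simp, fun _ _ => by simp⟩) (p + 2) ?_
    intro v
    rw [NambuAux.hat_ofFn]
    ext z
    rw [hψ₂]
    simp only [e1]
    rw [NambuAux.delta_eq br α Lop hLop αt B (p + 1) (dlt p (NambuAux.hat φ)) v z]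
    have := NambuAux.dd_nambu br α hmult hNambu Lop hLop αt hαt B hB p (NambuAux.hat φ) hML0
      (List.ofFn fun j => wedgeGen K n (v j)) (NambuAux.hat_tw φ αt α hφα)
    rw [this]
    rfl
  have e3 := e2 x
  rw [NambuAux.hat_ofFn] at e3
  rw [e3]
  rfl
end
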